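/- arXiv:2002.05284 — 2 statements merged into one kernel-verified Lean document; each statement's English description precedes it below -/
import Mathlib

section
/- Let p be an odd prime and n ≥ 1. Let P be the quotient of the graded-commutative 𝔽_p-algebra 𝔽_p[T_α : α ∈ 𝔽_p^n∖{0}] ⊗ Λ_{𝔽_p}[U_α : α ∈ 𝔽_p^n∖{0}] (the T_α central polynomial generators, the U_α anticommuting exterior generators) by the ideal generated by the elements T_α − k·T_{kα} and U_α − U_{kα} for all k ∈ 𝔽_p^× and nonzero α, and the elements T_αT_β + T_βT_γ + T_γT_α, U_αT_β + U_αT_γ − U_βT_γ − U_γT_β, and U_αU_β + U_βU_γ + U_γU_α for all nonzero α, β, γ ∈ 𝔽_p^n with α + β + γ = 0. Then the 𝔽_p-algebra homomorphism P → E determined by T_α ↦ t_α and U_α ↦ u_α is well defined, injective, and its image is exactly A; in particular P is isomorphic as an 𝔽_p-algebra to the subalgebra A of E. (A is a model of the coefficient ring of the geometric fixed points Φ^G(HZ/p) for G = (ℤ/p)^n.) -/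
open MvPolynomial

set_option synthInstance.maxHeartbeats 1000000
set_option maxHeartbeats 1000000

noncomputable section

/-- `K`, the field of fractions of `𝔽_p[x_1, …, x_n]`. -/
abbrev Kf (p n : ℕ) : Type _ := FractionRing (MvPolynomial (Fin n) (ZMod p))

/-- The constant `a ∈ 𝔽_p` regarded as an element of `K`. -/
def cK (p n : ℕ) (a : ZMod p) : Kf p n :=
  algebraMap (MvPolynomial (Fin n) (ZMod p)) (Kf p n) (C a)

/-- The variable `x_i` regarded as an element of `K`. -/
def xK (p n : ℕ) (i : Fin n) : Kf p n :=
  algebraMap (MvPolynomial (Fin n) (ZMod p)) (Kf p n) (X i)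

/-- The linear form `z_α = Σ_i α_i x_i ∈ K`. -/
def zf (p n : ℕ) (α : Fin n → ZMod p) : Kf p n := ∑ i, cK p n (α i) * xK p n i

/-- `t_α = z_α⁻¹ ∈ K`. -/
def tf (p n : ℕ) [Fact (Nat.Prime p)] (α : Fin n → ZMod p) : Kf p n := (zf p n α)⁻¹

/-- `E`, the exterior algebra over `K` on an `n`-dimensional `K`-vector space
with basis `dx_1, …, dx_n`. -/
abbrev Ef (p n : ℕ) : Type _ := ExteriorAlgebra (Kf p n) (Fin n → Kf p n)

/-- `dx_i ∈ E`. -/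
def dxE (p n : ℕ) (i : Fin n) : Ef p n :=
  ExteriorAlgebra.ι (Kf p n) (Pi.single i 1)

/-- `dz_α = Σ_i α_i dx_i ∈ E`. -/
def dzf (p n : ℕ) (α : Fin n → ZMod p) : Ef p n :=
  ∑ i, algebraMap (Kf p n) (Ef p n) (cK p n (α i)) * dxE p n i

/-- `t_α ∈ K ⊆ E`. -/
def tE (p n : ℕ) [Fact (Nat.Prime p)] (α : Fin n → ZMod p) : Ef p n :=
  algebraMap (Kf p n) (Ef p n) (tf p n α)

/-- `u_α = t_α · dz_α ∈ E`. -/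
def uf (p n : ℕ) [Fact (Nat.Prime p)] (α : Fin n → ZMod p) : Ef p n :=
  tE p n α * dzf p n α

/-- `E` is an `𝔽_p`-algebra (via `𝔽_p ⊆ K ⊆ E`). -/
instance instAlgZModEf (p n : ℕ) : Algebra (ZMod p) (Ef p n) :=
  RingHom.toAlgebra' ((algebraMap (Kf p n) (Ef p n)).comp (algebraMap (ZMod p) (Kf p n)))
    (fun c x => by
      simpa using Algebra.commutes (algebraMap (ZMod p) (Kf p n) c) x)

/-- `A ⊆ E`, the `𝔽_p`-subalgebra generated by all `t_α` and `u_α`, `α ∈ 𝔽_p^n ∖ {0}`. -/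
def Af (p n : ℕ) [Fact (Nat.Prime p)] : Subalgebra (ZMod p) (Ef p n) :=
  Algebra.adjoin (ZMod p)
    {x | ∃ α : Fin n → ZMod p, α ≠ 0 ∧ (x = tE p n α ∨ x = uf p n α)}

/-- The nonzero vectors of `𝔽_p^n`. -/
abbrev Nz (p n : ℕ) : Type _ := {α : Fin n → ZMod p // α ≠ 0}

/-- The free (noncommutative) `𝔽_p`-algebra on generators `T_α, U_α`, `α ∈ 𝔽_p^n ∖ {0}`. -/
abbrev FA (p n : ℕ) : Type _ := FreeAlgebra (ZMod p) (Nz p n ⊕ Nz p n)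

/-- The generator `T_α`. -/
def Tg (p n : ℕ) (α : Nz p n) : FA p n := FreeAlgebra.ι (ZMod p) (Sum.inl α)

/-- The generator `U_α`. -/
def Ug (p n : ℕ) (α : Nz p n) : FA p n := FreeAlgebra.ι (ZMod p) (Sum.inr α)

/-- Scalar multiple `kα` of a nonzero vector by a unit `k ∈ 𝔽_p^×`. -/
def smNz (p n : ℕ) (k : (ZMod p)ˣ) (α : Nz p n) : Nz p n :=
  ⟨(k : ZMod p) • α.1, fun h => α.2 (by
    have := congrArg (fun v => (k⁻¹ : ZMod p) • v) h
    simpa [smul_smul] using this)⟩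

/-- The relations presenting `P`: the `T_α` are central polynomial generators, the `U_α` are
anticommuting exterior generators, the relation identifying `T_α` with `k·T_{kα}` and `U_α`
with `U_{kα}`, and for all nonzero `α, β, γ` with `α + β + γ = 0` the relations
`T_αT_β + T_βT_γ + T_γT_α = 0`, `U_αT_β + U_αT_γ − U_βT_γ − U_γT_β = 0`,
`U_αU_β + U_βU_γ + U_γU_α = 0`. -/
inductive PRel (p n : ℕ) : FA p n → FA p n → Prop
  | t_comm (α β : Nz p n) : PRel p n (Tg p n α * Tg p n β) (Tg p n β * Tg p n α)
  | tu_comm (α β : Nz p n) : PRel p n (Tg p n α * Ug p n β) (Ug p n β * Tg p n α)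
  | u_anticomm (α β : Nz p n) : PRel p n (Ug p n α * Ug p n β) (-(Ug p n β * Ug p n α))
  | u_sq (α : Nz p n) : PRel p n (Ug p n α * Ug p n α) 0
  | t_scalar (k : (ZMod p)ˣ) (α : Nz p n) :
      PRel p n (Tg p n α)
        (algebraMap (ZMod p) (FA p n) (k : ZMod p) * Tg p n (smNz p n k α))
  | u_scalar (k : (ZMod p)ˣ) (α : Nz p n) :
      PRel p n (Ug p n α) (Ug p n (smNz p n k α))
  | ttt (α β γ : Nz p n) (h : α.1 + β.1 + γ.1 = 0) :
      PRel p n (Tg p n α * Tg p n β + Tg p n β * Tg p n γ + Tg p n γ * Tg p n α) 0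
  | utt (α β γ : Nz p n) (h : α.1 + β.1 + γ.1 = 0) :
      PRel p n (Ug p n α * Tg p n β + Ug p n α * Tg p n γ
        - Ug p n β * Tg p n γ - Ug p n γ * Tg p n β) 0
  | uuu (α β γ : Nz p n) (h : α.1 + β.1 + γ.1 = 0) :
      PRel p n (Ug p n α * Ug p n β + Ug p n β * Ug p n γ + Ug p n γ * Ug p n α) 0

/-- `P`, the quotient of the graded-commutative algebra
`𝔽_p[T_α] ⊗ Λ[U_α]` by the ideal generated by the listed relations. -/
abbrev Pf (p n : ℕ) : Type _ := RingQuot (PRel p n)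

/-- The class of `T_α` in `P`. -/
def TP (p n : ℕ) (α : Nz p n) : Pf p n :=
  RingQuot.mkAlgHom (ZMod p) (PRel p n) (Tg p n α)

/-- The class of `U_α` in `P`. -/
def UP (p n : ℕ) (α : Nz p n) : Pf p n :=
  RingQuot.mkAlgHom (ZMod p) (PRel p n) (Ug p n α)


theorem pf_term {F K A : Type*} [Field F] [Field K] [Algebra F K] [DecidableEq A] (x : K)
    (hx : Transcendental F x) (a : A → F) (ha : Function.Injective a)
    (B : Finset A) (N : ℕ) (α : A) (hα : α ∈ B) (k : ℕ) (β : A) (hβ : β ∈ B) (j : ℕ) (hj : j < N)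
    (h : β = α → j < k) :
    ∃ W : Polynomial F, W.eval (-a α) = 0 ∧ Polynomial.aeval x W =
      ((x + algebraMap F K (a α)) ^ (k+1) * ∏ b ∈ B.erase α, (x + algebraMap F K (a b)) ^ N) *
        ((x + algebraMap F K (a β))⁻¹) ^ (j+1) := by
  have hne : ∀ b, x + algebraMap F K (a b) ≠ 0 := by
    intro b hb
    apply hx
    refine ⟨Polynomial.X + Polynomial.C (a b), Polynomial.X_add_C_ne_zero _, by simpa using hb⟩
  by_cases hab : β = α
  · subst hab
    have hjk := h rfl
    refine ⟨(Polynomial.X + Polynomial.C (a β)) ^ (k - j) *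
      ∏ b ∈ B.erase β, (Polynomial.X + Polynomial.C (a b)) ^ N, ?_, ?_⟩
    · have : k - j ≠ 0 := by omega
      simp [this]
    · simp only [map_mul, map_pow, map_add, Polynomial.aeval_X, Polynomial.aeval_C, map_prod]
      have : k + 1 = (k - j) + (j+1) := by omega
      rw [this, pow_add]
      have h1 := hne β
      rw [inv_pow]
      field_simp
  · refine ⟨(Polynomial.X + Polynomial.C (a α)) ^ (k + 1) *
      ((∏ b ∈ (B.erase α).erase β, (Polynomial.X + Polynomial.C (a b)) ^ N) *
        (Polynomial.X + Polynomial.C (a β)) ^ (N - (j+1))), ?_, ?_⟩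
    · simp
    · have hmem : β ∈ B.erase α := Finset.mem_erase.2 ⟨hab, hβ⟩
      rw [← Finset.prod_erase_mul _ _ hmem]
      simp only [map_mul, map_pow, map_add, Polynomial.aeval_X, Polynomial.aeval_C, map_prod]
      have : N = (N - (j+1)) + (j+1) := by omega
      have h2 : (x + algebraMap F K (a β)) ^ N =
        (x + algebraMap F K (a β)) ^ (N - (j+1)) * (x + algebraMap F K (a β)) ^ (j+1) := by
        rw [← pow_add, ← this]
      rw [h2]
      have h1 := hne β
      rw [inv_pow]
      field_simp

theorem pf_indep {F K A : Type*} [Field F] [Field K] [Algebra F K] (x : K)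
    (hx : Transcendental F x) (a : A → F) (ha : Function.Injective a) :
    LinearIndependent F (fun i : Option (A × ℕ) => i.elim (1 : K)
      (fun q => ((x + algebraMap F K (a q.1))⁻¹) ^ (q.2 + 1))) := by
  classical
  have hne : ∀ b, x + algebraMap F K (a b) ≠ 0 := by
    intro b hb
    apply hx
    refine ⟨Polynomial.X + Polynomial.C (a b), Polynomial.X_add_C_ne_zero _, by simpa using hb⟩
  rw [linearIndependent_iff]
  intro c hc
  have key : ∀ α k, c (some (α, k)) = 0 := by
    by_contra! hcon
    obtain ⟨α, k0, hk0⟩ := hcon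
    -- maximal k
    let T : Finset ℕ := (c.support.biUnion (fun i => i.elim ∅ (fun q => {q.2})))
    have hT : ∀ β j, c (some (β, j)) ≠ 0 → j ∈ T := by
      intro β j h
      simp only [T, Finset.mem_biUnion]
      exact ⟨some (β, j), by simpa using h, by simp⟩
    let N := T.sup id + 1
    have hN : ∀ β j, c (some (β, j)) ≠ 0 → j < N := fun β j h =>
      Nat.lt_succ_of_le (Finset.le_sup (f := id) (hT β j h))
    obtain ⟨k, hk, hmax⟩ : ∃ k, c (some (α, k)) ≠ 0 ∧ ∀ j, c (some (α, j)) ≠ 0 → j ≤ k := by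
      have hne' : (T.filter (fun j => c (some (α, j)) ≠ 0)).Nonempty :=
        ⟨k0, Finset.mem_filter.2 ⟨hT _ _ hk0, hk0⟩⟩
      refine ⟨_, (Finset.mem_filter.1 (Finset.max'_mem _ hne')).2, fun j hj => ?_⟩
      exact Finset.le_max' _ _ (Finset.mem_filter.2 ⟨hT _ _ hj, hj⟩)
    let B : Finset A := (c.support.biUnion (fun i => i.elim ∅ (fun q => {q.1})))
    have hB : ∀ β j, c (some (β, j)) ≠ 0 → β ∈ B := by
      intro β j h
      simp only [B, Finset.mem_biUnion]
      exact ⟨some (β, j), by simpa using h, by simp⟩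
    set D : K := (x + algebraMap F K (a α)) ^ (k+1) *
      ∏ b ∈ B.erase α, (x + algebraMap F K (a b)) ^ N with hD
    have hmain : Polynomial.aeval x (∏ b ∈ B.erase α,
        (Polynomial.X + Polynomial.C (a b)) ^ N) =
        D * ((x + algebraMap F K (a α))⁻¹) ^ (k + 1) := by
      simp only [map_pow, map_add, Polynomial.aeval_X, Polynomial.aeval_C, map_prod, hD]
      have h1 := hne α
      rw [inv_pow]
      field_simp
    have hterm : ∀ i : Option (A × ℕ), ∃ W : Polynomial F, (c i ≠ 0 →
        Polynomial.aeval x W = D * (i.elim (1 : K)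
          (fun q => ((x + algebraMap F K (a q.1))⁻¹) ^ (q.2 + 1)))) ∧
        (c i ≠ 0 → i ≠ some (α, k) → W.eval (-a α) = 0) ∧
        (i = some (α, k) → W.eval (-a α) ≠ 0) := by
      intro i
      by_cases hi : i = some (α, k)
      · subst hi
        refine ⟨_, fun _ => hmain, fun _ h => absurd rfl h, fun _ => ?_⟩
        rw [Polynomial.eval_prod, Finset.prod_ne_zero_iff]
        intro b hb
        simp only [Polynomial.eval_pow, Polynomial.eval_add, Polynomial.eval_X,
          Polynomial.eval_C]
        apply pow_ne_zero
        intro h0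
        exact (Finset.mem_erase.1 hb).1 (ha (by linear_combination h0))
      by_cases hci : c i = 0
      · exact ⟨0, fun h => absurd hci h, fun h => absurd hci h, fun h => absurd h hi⟩
      rcases i with _ | ⟨β, j⟩
      · refine ⟨(Polynomial.X + Polynomial.C (a α)) ^ (k + 1) * ∏ b ∈ B.erase α,
          (Polynomial.X + Polynomial.C (a b)) ^ N, fun _ => ?_, fun _ _ => ?_, fun h => absurd h hi⟩
        · simp [hD]
        · simp
      · obtain ⟨W, h1, h2⟩ := pf_term x hx a ha B N α (hB _ _ hk) k β (hB _ _ hci) j (hN _ _ hci) (by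
          rintro rfl
          refine lt_of_le_of_ne (hmax _ hci) ?_
          rintro rfl
          exact hi rfl)
        exact ⟨W, fun _ => h2, fun _ _ => h1, fun h => absurd h hi⟩
    choose W hW1 hW2 hW3 using hterm
    have hsum : Polynomial.aeval x (∑ i ∈ c.support, c i • W i) = 0 := by
      rw [map_sum]
      have : ∀ i ∈ c.support, Polynomial.aeval x (c i • W i) = D * (c i • (i.elim (1 : K)
          (fun q => ((x + algebraMap F K (a q.1))⁻¹) ^ (q.2 + 1)))) := by
        intro i hi
        rw [map_smul, hW1 i (by simpa using hi), mul_smul_comm]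
      rw [Finset.sum_congr rfl this, ← Finset.mul_sum]
      rw [Finsupp.linearCombination_apply, Finsupp.sum] at hc
      rw [hc, mul_zero]
    have hzero : ∑ i ∈ c.support, c i • W i = 0 := by
      by_contra hne0
      exact hx ⟨_, hne0, hsum⟩
    have hev := congrArg (Polynomial.eval (-a α)) hzero
    rw [Polynomial.eval_finsetSum, Finset.sum_eq_single (some (α, k))] at hev
    · simp only [Polynomial.eval_smul, smul_eq_mul, Polynomial.eval_zero, mul_eq_zero] at hev
      exact hev.elim hk (hW3 _ rfl)
    · intro i hi hne'
      simp [hW2 i (by simpa using hi) hne']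
    · intro h
      exact absurd (by simpa using hk) h
  ext i
  rcases i with _ | ⟨α, k⟩
  · have : c = Finsupp.single none (c none) := by
      ext i
      rcases i with _ | ⟨α, k⟩
      · simp
      · simp [key]
    rw [this] at hc
    simpa using hc
  · simp [key]

section ext
variable {K : Type*} [Field K] {n : ℕ}

/-- basis vectors of the exterior algebra -/
noncomputable def dxG (K : Type*) [Field K] (n : ℕ) (i : Fin n) : ExteriorAlgebra K (Fin n → K) :=
  ExteriorAlgebra.ι K (Pi.single i 1)

/-- right contraction with the `j`-th coordinate -/
noncomputable def ctr (K : Type*) [Field K] (n : ℕ) (j : Fin n) :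
    ExteriorAlgebra K (Fin n → K) →ₗ[K] ExteriorAlgebra K (Fin n → K) :=
  (CliffordAlgebra.contractRight (Q := (0 : QuadraticForm K (Fin n → K)))).flip (LinearMap.proj j)

theorem ctr_mul_ι (j : Fin n) (b : ExteriorAlgebra K (Fin n → K)) (v : Fin n → K) :
    ctr K n j (b * ExteriorAlgebra.ι K v) = v j • b - ctr K n j b * ExteriorAlgebra.ι K v :=
  CliffordAlgebra.contractRight_mul_ι (Q := (0 : QuadraticForm K (Fin n → K))) _ v b

theorem ctr_algebraMap (j : Fin n) (r : K) :
    ctr K n j (algebraMap K _ r) = 0 :=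
  CliffordAlgebra.contractRight_algebraMap (Q := (0 : QuadraticForm K (Fin n → K))) _ r

theorem ctr_comm (i j : Fin n) (b : ExteriorAlgebra K (Fin n → K)) :
    ctr K n i (ctr K n j b) = - ctr K n j (ctr K n i b) :=
  CliffordAlgebra.contractRight_comm (Q := (0 : QuadraticForm K (Fin n → K))) _ _ b

theorem ctr_self (j : Fin n) (b : ExteriorAlgebra K (Fin n → K)) :
    ctr K n j (ctr K n j b) = 0 :=
  CliffordAlgebra.contractRight_contractRight (Q := (0 : QuadraticForm K (Fin n → K))) _ b

/-- coordinates -/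
noncomputable def phi (K : Type*) [Field K] (n : ℕ) :
    List (Fin n) → ExteriorAlgebra K (Fin n → K) →ₗ[K] K
  | [] => (ExteriorAlgebra.algebraMapInv (R := K) (M := Fin n → K)).toLinearMap
  | j :: S => phi K n S ∘ₗ ctr K n j

/-- projection away from `dx_j` -/
noncomputable def pr (K : Type*) [Field K] (n : ℕ) (j : Fin n) 
    (b : ExteriorAlgebra K (Fin n → K)) : ExteriorAlgebra K (Fin n → K) :=
  b - ctr K n j b * ExteriorAlgebra.ι K (Pi.single j 1)

theorem ι_swap (v w : Fin n → K) : ExteriorAlgebra.ι K v * ExteriorAlgebra.ι K w =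
    - (ExteriorAlgebra.ι K w * ExteriorAlgebra.ι K v) :=
  eq_neg_of_add_eq_zero_left (ExteriorAlgebra.ι_add_mul_swap v w)

theorem pr_ne (i j : Fin n) (h : i ≠ j) (b : ExteriorAlgebra K (Fin n → K)) :
    pr K n j (b * ExteriorAlgebra.ι K (Pi.single i 1)) =
      pr K n j b * ExteriorAlgebra.ι K (Pi.single i 1) := by
  simp only [pr, ctr_mul_ι, Pi.single_eq_of_ne' h, zero_smul, zero_sub, neg_mul, sub_neg_eq_add,
    sub_mul, mul_assoc]
  rw [ι_swap (Pi.single j 1) (Pi.single i 1)]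
  simp

theorem pr_self (j : Fin n) (b : ExteriorAlgebra K (Fin n → K)) :
    pr K n j (b * ExteriorAlgebra.ι K (Pi.single j 1)) = 0 := by
  simp only [pr, ctr_mul_ι, Pi.single_eq_same, one_smul, sub_mul, mul_assoc,
    ExteriorAlgebra.ι_sq_zero, mul_zero, sub_zero, sub_self]

theorem pr_add (j : Fin n) (b c : ExteriorAlgebra K (Fin n → K)) :
    pr K n j (b + c) = pr K n j b + pr K n j c := by
  simp only [pr, map_add, add_mul]; abel

theorem pr_zero (j : Fin n) : pr K n j 0 = 0 := by simp [pr]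

theorem prl_add (l : List (Fin n)) (b c : ExteriorAlgebra K (Fin n → K)) :
    l.foldr (pr K n) (b + c) = l.foldr (pr K n) b + l.foldr (pr K n) c := by
  induction l with
  | nil => rfl
  | cons j l ih => simp only [List.foldr_cons, ih, pr_add]

theorem prl_zero (l : List (Fin n)) : l.foldr (pr K n) 0 = 0 := by
  induction l with
  | nil => rfl
  | cons j l ih => simp only [List.foldr_cons, ih, pr_zero]

theorem prl_or (l : List (Fin n)) (i : Fin n) (b : ExteriorAlgebra K (Fin n → K)) :
    l.foldr (pr K n) (b * ExteriorAlgebra.ι K (Pi.single i 1)) = 0 ∨ (i ∉ l ∧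
    l.foldr (pr K n) (b * ExteriorAlgebra.ι K (Pi.single i 1)) =
      l.foldr (pr K n) b * ExteriorAlgebra.ι K (Pi.single i 1)) := by
  induction l with
  | nil => right; simp
  | cons j l ih =>
    simp only [List.foldr_cons]
    rcases ih with ih | ⟨h1, ih⟩
    · left; rw [ih, pr_zero]
    · by_cases h : i = j
      · subst h; left; rw [ih, pr_self]
      · right; refine ⟨by simp [h, h1], ?_⟩
        rw [ih, pr_ne _ _ h]

theorem prl_scalar (b : ExteriorAlgebra K (Fin n → K)) :
    ∃ r : K, (List.finRange n).foldr (pr K n) b = algebraMap K _ r := by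
  induction b using CliffordAlgebra.right_induction with
  | algebraMap r =>
    refine ⟨r, ?_⟩
    induction (List.finRange n) with
    | nil => rfl
    | cons j l ih =>
      rw [List.foldr_cons, ih, pr]
      erw [ctr_algebraMap]
      simp
  | add x y hx hy =>
    obtain ⟨r, hr⟩ := hx
    obtain ⟨s, hs⟩ := hy
    exact ⟨r + s, by rw [prl_add, hr, hs, map_add]⟩
  | mul_ι m x _ =>
    refine ⟨0, ?_⟩
    have hm : m = ∑ i, m i • (Pi.single i (1 : K) : Fin n → K) := by
      ext j; simp [Finset.sum_apply, Pi.single_apply]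
    have : ∀ s : Finset (Fin n), (List.finRange n).foldr (pr K n)
        (x * ExteriorAlgebra.ι K (∑ i ∈ s, m i • (Pi.single i (1 : K) : Fin n → K))) = 0 := by
      classical
      intro s
      induction s using Finset.induction_on with
      | empty => simp [prl_zero]
      | insert i s hi ih =>
        rw [Finset.sum_insert hi, map_add, mul_add, prl_add, ih, add_zero, map_smul,
          mul_smul_comm, ← smul_mul_assoc]
        rcases prl_or (List.finRange n) i (m i • x) with h | ⟨h, _⟩
        · exact h
        · exact absurd (List.mem_finRange i) h
    rw [map_zero]
    have h2 := this Finset.univ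
    rw [← hm] at h2
    exact h2

theorem ctr_all_zero (b : ExteriorAlgebra K (Fin n → K)) (h : ∀ j, ctr K n j b = 0) :
    b = algebraMap K _ (phi K n [] b) := by
  obtain ⟨r, hr⟩ := prl_scalar b
  have : ∀ l : List (Fin n), l.foldr (pr K n) b = b := by
    intro l
    induction l with
    | nil => rfl
    | cons j l ih => rw [List.foldr_cons, ih, pr, h j]; simp
  rw [this] at hr
  rw [hr]
  simp [phi]

theorem phi_sep (b : ExteriorAlgebra K (Fin n → K)) (h : ∀ S, phi K n S b = 0) : b = 0 := by
  classical
  have : ∀ s : Finset (Fin n), ∀ b : ExteriorAlgebra K (Fin n → K), (∀ S, phi K n S b = 0) →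
      (∀ j, j ∉ s → ctr K n j b = 0) → b = 0 := by
    intro s
    induction s using Finset.induction_on with
    | empty =>
      intro b h h2
      rw [ctr_all_zero b (fun j => h2 j (by simp)), h [], map_zero]
    | insert i s hi ih =>
      intro b h h2
      have h3 : ctr K n i b = 0 := by
        apply ih
        · intro S; exact h (i :: S)
        · intro j hj
          by_cases hji : j = i
          · subst hji; exact ctr_self _ _
          · rw [ctr_comm, h2 j (by simp [hji, hj])]; simp
      apply ih b h
      intro j hj
      by_cases hji : j = i
      · subst hji; exact h3
      · exact h2 j (by simp [hji, hj])
  exact this Finset.univ b h (by simp)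

/-- elements with coordinates in `F` and not involving `dx_j` for `j ≥ m`. -/
def GoodE (F : Subfield K) (m : ℕ) (b : ExteriorAlgebra K (Fin n → K)) : Prop :=
  (∀ S, phi K n S b ∈ F) ∧ ∀ j : Fin n, m ≤ j.1 → ctr K n j b = 0

theorem GoodE.add {F : Subfield K} {m : ℕ} {b c : ExteriorAlgebra K (Fin n → K)}
    (hb : GoodE F m b) (hc : GoodE F m c) : GoodE F m (b + c) :=
  ⟨fun S => by rw [map_add]; exact F.add_mem (hb.1 S) (hc.1 S),
   fun j hj => by rw [map_add, hb.2 j hj, hc.2 j hj, add_zero]⟩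

theorem GoodE.neg {F : Subfield K} {m : ℕ} {b : ExteriorAlgebra K (Fin n → K)}
    (hb : GoodE F m b) : GoodE F m (-b) :=
  ⟨fun S => by rw [map_neg]; exact F.neg_mem (hb.1 S),
   fun j hj => by rw [map_neg, hb.2 j hj, neg_zero]⟩

theorem GoodE.smul {F : Subfield K} {m : ℕ} {b : ExteriorAlgebra K (Fin n → K)}
    (hb : GoodE F m b) {r : K} (hr : r ∈ F) : GoodE F m (r • b) :=
  ⟨fun S => by rw [map_smul]; exact F.mul_mem hr (hb.1 S),
   fun j hj => by rw [map_smul, hb.2 j hj, smul_zero]⟩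

theorem GoodE.one {F : Subfield K} {m : ℕ} : GoodE F m (1 : ExteriorAlgebra K (Fin n → K)) := by
  have h : ∀ j, ctr K n j (1 : ExteriorAlgebra K (Fin n → K)) = 0 := fun j => by
    have := ctr_algebraMap (n := n) j (1 : K)
    rwa [map_one] at this
  refine ⟨fun S => ?_, fun j _ => h j⟩
  cases S with
  | nil => simp [phi, F.one_mem]
  | cons j S => simp [phi, h, F.zero_mem]

theorem GoodE.ctr {F : Subfield K} {m : ℕ} {b : ExteriorAlgebra K (Fin n → K)}
    (hb : GoodE F m b) (i : Fin n) : GoodE F m (ctr K n i b) :=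
  ⟨fun S => hb.1 (i :: S),
   fun j hj => by rw [ctr_comm, hb.2 j hj]; simp⟩

theorem GoodE.mul_ι {F : Subfield K} {m : ℕ} {b : ExteriorAlgebra K (Fin n → K)}
    (hb : GoodE F m b) {v : Fin n → K} (hv : ∀ j, v j ∈ F) (hv2 : ∀ j : Fin n, m ≤ j.1 → v j = 0) :
    GoodE F m (b * ExteriorAlgebra.ι K v) := by
  refine ⟨fun S => ?_, fun j hj => ?_⟩
  · induction S generalizing b with
    | nil => simp [phi, ExteriorAlgebra.algebraMapInv, F.zero_mem]
    | cons j S ih =>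
      simp only [phi, LinearMap.comp_apply, ctr_mul_ι, map_sub]
      exact F.sub_mem ((hb.smul (hv j)).1 S) (ih (hb.ctr j))
  · rw [ctr_mul_ι, hv2 j hj, hb.2 j hj]; simp

/-- the key independence lemma -/
theorem key_indep {F : Subfield K} {m : ℕ} (hm : m < n) {I : Type*} (g : Option I → K)
    (hg : LinearIndependent F g) (v : I → (Fin n → K)) (hv : ∀ i, v i ⟨m, hm⟩ = 1)
    (q : Option I →₀ ExteriorAlgebra K (Fin n → K))
    (r : I →₀ ExteriorAlgebra K (Fin n → K))
    (hq : ∀ i, GoodE F m (q i)) (hr : ∀ i, GoodE F m (r i))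
    (h : q.sum (fun i a => a * algebraMap K _ (g i)) +
      r.sum (fun i a => a * (algebraMap K _ (g (some i)) * ExteriorAlgebra.ι K (v i))) = 0) :
    q = 0 ∧ r = 0 := by
  have gen : ∀ {J : Type _} (w : J → K) (hw : LinearIndependent F w)
      (c : J →₀ ExteriorAlgebra K (Fin n → K)) (hc : ∀ i, GoodE F m (c i))
      (h : ∑ i ∈ c.support, w i • c i = 0), c = 0 := by
    intro J w hw c hc h
    ext1 i
    apply phi_sep
    intro S
    by_cases hi : i ∈ c.support
    · have h1 := congrArg (phi K n S) h
      rw [map_sum, map_zero] at h1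
      have h2 := linearIndependent_iff'.1 hw c.support (fun i => ⟨phi K n S (c i), (hc i).1 S⟩) (by
        rw [← h1]
        refine Finset.sum_congr rfl fun i _ => ?_
        rw [map_smul, smul_eq_mul, mul_comm]
        rfl) i hi
      exact congrArg Subtype.val h2
    · rw [Finsupp.notMem_support_iff.1 hi, map_zero]
  have e1 : ∀ i, q i * algebraMap K _ (g i) = g i • q i := fun i => by
    rw [← Algebra.commutes, Algebra.smul_def]
  have e2 : ∀ i, r i * (algebraMap K _ (g (some i)) * ExteriorAlgebra.ι K (v i)) =
      g (some i) • (r i * ExteriorAlgebra.ι K (v i)) := fun i => by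
    rw [← mul_assoc, ← Algebra.commutes, Algebra.smul_def, mul_assoc]
  simp only [Finsupp.sum, e1, e2] at h
  have hr0 : r = 0 := by
    apply gen (fun i => g (some i)) (hg.comp some (Option.some_injective I)) r hr
    have h1 := congrArg (ctr K n ⟨m, hm⟩) h
    rw [map_add, map_sum, map_sum, map_zero] at h1
    have h2 : ∀ i ∈ q.support, ctr K n ⟨m, hm⟩ (g i • q i) = 0 := fun i _ => by
      rw [map_smul, (hq i).2 _ le_rfl, smul_zero]
    have h3 : ∀ i ∈ r.support, ctr K n ⟨m, hm⟩ (g (some i) • (r i * ExteriorAlgebra.ι K (v i))) =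
        g (some i) • r i := fun i _ => by
      rw [map_smul, ctr_mul_ι, (hr i).2 _ le_rfl, hv, one_smul, zero_mul, sub_zero]
    rw [Finset.sum_congr rfl h2, Finset.sum_congr rfl h3, Finset.sum_const_zero, zero_add] at h1
    exact h1
  refine ⟨?_, hr0⟩
  apply gen g hg q hq
  simpa [hr0] using h

end ext
section spanning

/-- a ring with elements satisfying the defining relations of `P` -/
structure PData (p n : ℕ) {R : Type} [Ring R] [Algebra (ZMod p) R] (T U : Nz p n → R) : Prop where
  PT_comm (α β : Nz p n) : T α * T β = T β * T α
  PTU_comm (α β : Nz p n) : T α * U β = U β * T α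
  PUU_anti (α β : Nz p n) : U α * U β = -(U β * U α)
  PU_sq (α : Nz p n) : U α * U α = 0
  PT_scalar (k : (ZMod p)ˣ) (α : Nz p n) :
    T α = algebraMap (ZMod p) R (k : ZMod p) * T (smNz p n k α)
  PU_scalar (k : (ZMod p)ˣ) (α : Nz p n) : U α = U (smNz p n k α)
  P_ttt (α β γ : Nz p n) (h : α.1 + β.1 + γ.1 = 0) : T α * T β + T β * T γ + T γ * T α = 0
  P_utt (α β γ : Nz p n) (h : α.1 + β.1 + γ.1 = 0) :
    U α * T β + U α * T γ - U β * T γ - U γ * T β = 0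
  P_uuu (α β γ : Nz p n) (h : α.1 + β.1 + γ.1 = 0) : U α * U β + U β * U γ + U γ * U α = 0

variable {p n : ℕ} {R : Type} [Ring R] [Algebra (ZMod p) R] {T U : Nz p n → R}

/-- subalgebra of `P` generated by vectors supported on the first `m` coordinates -/
def Qs (T U : Nz p n → R) (m : ℕ) : Subalgebra (ZMod p) (R) :=
  Algebra.adjoin (ZMod p) {y | ∃ α : Nz p n, (∀ i : Fin n, m ≤ i.1 → α.1 i = 0) ∧
    (y = T α ∨ y = U α)}

/-- normalised vectors of level `m` -/
abbrev Lv (p n m : ℕ) (hm : m < n) : Type :=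
  {α : Nz p n // α.1 ⟨m, hm⟩ = 1 ∧ ∀ i : Fin n, m < i.1 → α.1 i = 0}

/-- first family -/
def bT (T U : Nz p n → R) (m : ℕ) (hm : m < n) (i : Option (Lv p n m hm × ℕ)) : R :=
  i.elim 1 (fun q => T q.1.1 ^ (q.2 + 1))

/-- second family -/
def bU (T U : Nz p n → R) (m : ℕ) (hm : m < n) (i : Lv p n m hm × ℕ) : R :=
  T i.1.1 ^ i.2 * U i.1.1

/-- span of the two families -/
def Sp (T U : Nz p n → R) (m : ℕ) (hm : m < n) : Submodule (Qs T U m) (R) :=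
  Submodule.span (Qs T U m) (Set.range (bT T U m hm) ∪ Set.range (bU T U m hm))

theorem pair_rel (H : PData p n T U) {m : ℕ} {hm : m < n} (α β : Lv p n m hm) (hne : α ≠ β) :
    ∃ δ : Nz p n, (∀ i : Fin n, m ≤ i.1 → δ.1 i = 0) ∧
    (T α.1 * T β.1 = T δ * T α.1 - T δ * T β.1) ∧
    (U α.1 * T β.1 = T δ * U α.1 - T δ * U β.1
      + U δ * T β.1) ∧
    (U α.1 * U β.1 = U δ * U β.1 - U δ * U α.1) := by
  obtain ⟨α, ha1, ha2⟩ := α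
  obtain ⟨β, hb1, hb2⟩ := β
  have hne' : α.1 ≠ β.1 := fun h => hne (by
    have : α = β := Subtype.ext h
    subst this; rfl)
  let δ : Nz p n := ⟨β.1 - α.1, fun h => hne' (sub_eq_zero.1 h).symm⟩
  have hsum : α.1 + (smNz p n (-1) β).1 + δ.1 = 0 := by
    simp only [smNz, δ, Units.val_neg, Units.val_one, neg_smul, one_smul]; abel
  have h1 := H.P_ttt _ _ _ hsum
  have h2 := H.P_utt _ _ _ hsum
  have h3 := H.P_uuu _ _ _ hsum
  have e1 : T (smNz p n (-1) β) = - T β := by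
    rw [H.PT_scalar (-1) β]; simp only [Units.val_neg, Units.val_one, map_neg, map_one, neg_mul, one_mul, neg_neg]
  rw [e1] at h1 h2
  rw [← H.PU_scalar] at h2 h3
  refine ⟨δ, ?_, ?_, ?_, ?_⟩
  · intro i hi
    simp only [δ, Pi.sub_apply]
    rcases eq_or_lt_of_le hi with h | h
    · have : i = ⟨m, hm⟩ := Fin.ext h.symm
      rw [this, ha1, hb1, sub_self]
    · rw [ha2 i h, hb2 i h, sub_self]
  · rw [mul_neg, neg_mul, H.PT_comm β δ] at h1
    show T α * T β = _
    rw [← sub_eq_zero, ← neg_eq_zero, ← h1]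
    abel
  · rw [mul_neg, mul_neg] at h2
    show U α * T β = _
    simp only [H.PTU_comm δ]
    rw [← sub_eq_zero, ← neg_eq_zero, ← h2]
    abel
  · rw [H.PUU_anti β δ] at h3
    show U α * U β = _
    rw [← sub_eq_zero, ← h3]
    abel

variable {m : ℕ} {hm : m < n}

theorem Sp_T {δ : Nz p n} (hδ : ∀ i : Fin n, m ≤ i.1 → δ.1 i = 0) {s : R}
    (hs : s ∈ Sp T U m hm) : T δ * s ∈ Sp T U m hm :=
  (Sp T U m hm).smul_mem (⟨T δ, Algebra.subset_adjoin ⟨δ, hδ, Or.inl rfl⟩⟩ : Qs T U m) hs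

theorem Sp_U {δ : Nz p n} (hδ : ∀ i : Fin n, m ≤ i.1 → δ.1 i = 0) {s : R}
    (hs : s ∈ Sp T U m hm) : U δ * s ∈ Sp T U m hm :=
  (Sp T U m hm).smul_mem (⟨U δ, Algebra.subset_adjoin ⟨δ, hδ, Or.inr rfl⟩⟩ : Qs T U m) hs

theorem Sp_one : (1 : R) ∈ Sp T U m hm :=
  Submodule.subset_span (Or.inl ⟨none, rfl⟩)

theorem Sp_bT (α : Lv p n m hm) (k : ℕ) : T α.1 ^ (k+1) ∈ Sp T U m hm :=
  Submodule.subset_span (Or.inl ⟨some (α, k), rfl⟩)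

theorem Sp_bU (α : Lv p n m hm) (k : ℕ) : T α.1 ^ k * U α.1 ∈ Sp T U m hm :=
  Submodule.subset_span (Or.inr ⟨(α, k), rfl⟩)

theorem Sp_mul {g : R} (h1 : g ∈ Sp T U m hm)
    (hT : ∀ (α : Lv p n m hm) k, T α.1 ^ (k+1) * g ∈ Sp T U m hm)
    (hU : ∀ (α : Lv p n m hm) k, T α.1 ^ k * U α.1 * g ∈ Sp T U m hm)
    {s : R} (hs : s ∈ Sp T U m hm) : s * g ∈ Sp T U m hm := by
  induction hs using Submodule.span_induction with
  | mem x hx =>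
    rcases hx with ⟨_ | ⟨α, k⟩, rfl⟩ | ⟨⟨α, k⟩, rfl⟩
    · simpa [bT] using h1
    · exact hT α k
    · exact hU α k
  | zero => rw [zero_mul]; exact Submodule.zero_mem _
  | add x y _ _ hx hy => rw [add_mul]; exact Submodule.add_mem _ hx hy
  | smul q x _ hx => rw [smul_mul_assoc]; exact Submodule.smul_mem _ q hx

theorem PTT_comm' (H : PData p n T U) (α β : Nz p n) (k : ℕ) :
    T α ^ k * T β = T β * T α ^ k :=
  (Commute.pow_left (show Commute _ _ from H.PT_comm α β) k).eq

theorem PTU_comm' (H : PData p n T U) (α β : Nz p n) (k : ℕ) :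
    T α ^ k * U β = U β * T α ^ k :=
  (Commute.pow_left (show Commute _ _ from H.PTU_comm α β) k).eq

theorem Sp_lowT (H : PData p n T U) {δ : Nz p n} (hδ : ∀ i : Fin n, m ≤ i.1 → δ.1 i = 0) {s : R}
    (hs : s ∈ Sp T U m hm) : s * T δ ∈ Sp T U m hm := by
  refine Sp_mul (by simpa using Sp_T hδ (Sp_one (T := T) (U := U) (m := m) (hm := hm))) (fun α k => ?_) (fun α k => ?_) hs
  · rw [PTT_comm' H]; exact Sp_T hδ (Sp_bT α k)
  · rw [mul_assoc, ← H.PTU_comm, ← mul_assoc, PTT_comm' H, mul_assoc]; exact Sp_T hδ (Sp_bU α k)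

theorem Sp_lowU (H : PData p n T U) {δ : Nz p n} (hδ : ∀ i : Fin n, m ≤ i.1 → δ.1 i = 0) {s : R}
    (hs : s ∈ Sp T U m hm) : s * U δ ∈ Sp T U m hm := by
  refine Sp_mul (by simpa using Sp_U hδ (Sp_one (T := T) (U := U) (m := m) (hm := hm))) (fun α k => ?_) (fun α k => ?_) hs
  · rw [PTU_comm' H]; exact Sp_U hδ (Sp_bT α k)
  · rw [mul_assoc, H.PUU_anti, mul_neg, ← mul_assoc, PTU_comm' H, mul_assoc]
    exact Submodule.neg_mem _ (Sp_U hδ (Sp_bU α k))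

theorem Sp_TT (H : PData p n T U) (α β : Lv p n m hm) (k : ℕ) : T α.1 ^ k * T β.1 ∈ Sp T U m hm := by
  by_cases h : α = β
  · subst h; rw [← pow_succ]; exact Sp_bT α k
  obtain ⟨δ, hδ, h1, h2, h3⟩ := pair_rel H α β h
  induction k with
  | zero => simpa using Sp_bT β 0
  | succ k ih =>
    have : T α.1 ^ (k+1) * T β.1 = T δ * T α.1 ^ (k+1) -
        T δ * (T α.1 ^ k * T β.1) := by
      rw [pow_succ, mul_assoc, h1, mul_sub, ← mul_assoc, ← mul_assoc, PTT_comm' H, mul_assoc,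
        mul_assoc]
    rw [this]
    exact Submodule.sub_mem _ (Sp_T hδ (Sp_bT α k)) (Sp_T hδ ih)

theorem Sp_UT (H : PData p n T U) (α β : Lv p n m hm) (k : ℕ) :
    T α.1 ^ k * U α.1 * T β.1 ∈ Sp T U m hm := by
  by_cases h : α = β
  · subst h; rw [mul_assoc, ← H.PTU_comm, ← mul_assoc, ← pow_succ]; exact Sp_bU α (k+1)
  obtain ⟨δ, hδ, h1, h2, h3⟩ := pair_rel H α β h
  induction k with
  | zero =>
    rw [pow_zero, one_mul, h2]
    refine Submodule.add_mem _ (Submodule.sub_mem _ (Sp_T hδ ?_) (Sp_T hδ ?_)) (Sp_U hδ ?_)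
    · simpa using Sp_bU α 0
    · simpa using Sp_bU β 0
    · simpa using Sp_bT β 0
  | succ k ih =>
    have : T α.1 ^ (k+1) * U α.1 * T β.1 =
        T δ * (T α.1 ^ (k+1) * U α.1) -
        T δ * (T α.1 ^ k * U α.1 * T β.1) := by
      calc T α.1 ^ (k+1) * U α.1 * T β.1
          = T α.1 ^ k * (T α.1 * T β.1) * U α.1 := by
            simp only [pow_succ, mul_assoc, H.PTU_comm β.1]
        _ = _ := by
            rw [h1, mul_sub, sub_mul, ← mul_assoc, PTT_comm' H, ← mul_assoc, PTT_comm' H]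
            simp only [pow_succ, mul_assoc, H.PTU_comm β.1]
    rw [this]
    exact Submodule.sub_mem _ (Sp_T hδ (Sp_bU α (k+1))) (Sp_T hδ ih)

theorem Sp_TU (H : PData p n T U) (α β : Lv p n m hm) (k : ℕ) : T α.1 ^ k * U β.1 ∈ Sp T U m hm := by
  by_cases h : α = β
  · subst h; exact Sp_bU α k
  obtain ⟨δ, hδ, h1, h2, h3⟩ := pair_rel H β α (Ne.symm h)
  induction k with
  | zero => simpa using Sp_bU β 0
  | succ k ih =>
    have : T α.1 ^ (k+1) * U β.1 = T δ * (T α.1 ^ k * U β.1) -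
        T δ * (T α.1 ^ k * U α.1) + U δ * T α.1 ^ (k+1) := by
      rw [pow_succ, mul_assoc, H.PTU_comm, h2, mul_add, mul_sub, ← mul_assoc, ← mul_assoc,
        ← mul_assoc, PTT_comm' H, PTU_comm' H]
      simp only [mul_assoc]
    rw [this]
    exact Submodule.add_mem _ (Submodule.sub_mem _ (Sp_T hδ ih) (Sp_T hδ (Sp_bU α k)))
      (Sp_U hδ (Sp_bT α k))

theorem Sp_UU (H : PData p n T U) (α β : Lv p n m hm) (k : ℕ) :
    T α.1 ^ k * U α.1 * U β.1 ∈ Sp T U m hm := by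
  by_cases h : α = β
  · subst h; rw [mul_assoc, H.PU_sq, mul_zero]; exact Submodule.zero_mem _
  obtain ⟨δ, hδ, h1, h2, h3⟩ := pair_rel H β α (Ne.symm h)
  induction k with
  | zero =>
    rw [pow_zero, one_mul, H.PUU_anti, h3]
    refine Submodule.neg_mem _ (Submodule.sub_mem _ (Sp_U hδ ?_) (Sp_U hδ ?_))
    · simpa using Sp_bU α 0
    · simpa using Sp_bU β 0
  | succ k ih =>
    have : T α.1 ^ (k+1) * U α.1 * U β.1 =
        T δ * (T α.1 ^ k * U α.1 * U β.1) -
        U δ * (T α.1 ^ (k+1) * U α.1) := by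
      calc T α.1 ^ (k+1) * U α.1 * U β.1
          = T α.1 ^ k * (U α.1 * (U β.1 * T α.1)) := by
            rw [← H.PTU_comm α.1 β.1, ← mul_assoc (U α.1), ← H.PTU_comm α.1 α.1]
            simp only [pow_succ, mul_assoc]
        _ = T α.1 ^ k * (U α.1 * (T δ * U β.1))
            - T α.1 ^ k * (U α.1 * (T δ * U α.1))
            + T α.1 ^ k * (U α.1 * (U δ * T α.1)) := by
            rw [h2]; simp only [mul_add, mul_sub]
        _ = T δ * (T α.1 ^ k * U α.1 * U β.1) - 0
            + - (U δ * (T α.1 ^ (k+1) * U α.1)) := by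
            congr 2
            · rw [← mul_assoc (U α.1), ← H.PTU_comm δ, mul_assoc, ← mul_assoc, PTT_comm' H]
              simp only [mul_assoc]
            · rw [H.PTU_comm δ, ← mul_assoc (U α.1), H.PU_sq, zero_mul, mul_zero]
            · rw [← mul_assoc (U α.1), H.PUU_anti α.1 δ, neg_mul, mul_neg, mul_assoc,
                ← H.PTU_comm, ← mul_assoc, PTU_comm' H]
              simp only [pow_succ, mul_assoc]
        _ = _ := by abel
    rw [this]
    exact Submodule.sub_mem _ (Sp_T hδ ih) (Sp_U hδ (Sp_bU α (k+1)))

theorem Sp_algMul (c : ZMod p) {s : R} (hs : s ∈ Sp T U m hm) :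
    algebraMap (ZMod p) (R) c * s ∈ Sp T U m hm :=
  (Sp T U m hm).smul_mem (algebraMap (ZMod p) (Qs T U m) c) hs

theorem Sp_Lv_T (H : PData p n T U) (β : Lv p n m hm) {s : R}
    (hs : s ∈ Sp T U m hm) : s * T β.1 ∈ Sp T U m hm :=
  Sp_mul (by simpa using Sp_bT β 0) (fun α k => Sp_TT H α β (k+1)) (fun α k => Sp_UT H α β k) hs

theorem Sp_Lv_U (H : PData p n T U) (β : Lv p n m hm) {s : R}
    (hs : s ∈ Sp T U m hm) : s * U β.1 ∈ Sp T U m hm :=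
  Sp_mul (by simpa using Sp_bU β 0) (fun α k => Sp_TU H α β (k+1)) (fun α k => Sp_UU H α β k) hs

theorem Sp_gen (H : PData p n T U) [Fact (Nat.Prime p)] (α : Nz p n) (hα : ∀ i : Fin n, m + 1 ≤ i.1 → α.1 i = 0)
    {s : R} (hs : s ∈ Sp T U m hm) :
    s * T α ∈ Sp T U m hm ∧ s * U α ∈ Sp T U m hm := by
  by_cases h0 : α.1 ⟨m, hm⟩ = 0
  · have hlow : ∀ i : Fin n, m ≤ i.1 → α.1 i = 0 := by
      intro i hi
      rcases eq_or_lt_of_le hi with h | h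
      · have : i = ⟨m, hm⟩ := Fin.ext h.symm
        rw [this, h0]
      · exact hα i h
    exact ⟨Sp_lowT H hlow hs, Sp_lowU H hlow hs⟩
  · let k : (ZMod p)ˣ := (Units.mk0 _ h0)⁻¹
    let β : Lv p n m hm := ⟨smNz p n k α, by simp [smNz, k, h0], fun i hi => by
      simp [smNz, hα i hi]⟩
    rw [H.PT_scalar k α, H.PU_scalar k α]
    refine ⟨?_, Sp_Lv_U H β hs⟩
    rw [← mul_assoc, ← Algebra.commutes, mul_assoc]
    exact Sp_algMul _ (Sp_Lv_T H β hs)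

theorem Qs_succ_le (H : PData p n T U) [Fact (Nat.Prime p)] {y : R} (hy : y ∈ Qs T U (m+1)) :
    y ∈ Sp T U m hm := by
  have : ∀ s ∈ Sp T U m hm, s * y ∈ Sp T U m hm := by
    induction hy using Algebra.adjoin_induction with
    | mem x hx =>
      intro s hs
      obtain ⟨α, hα, rfl | rfl⟩ := hx
      · exact (Sp_gen H α hα hs).1
      · exact (Sp_gen H α hα hs).2
    | algebraMap r => intro s hs; rw [← Algebra.commutes]; exact Sp_algMul r hs
    | add x y _ _ hx hy => intro s hs; rw [mul_add]; exact Submodule.add_mem _ (hx s hs) (hy s hs)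
    | mul x y _ _ hx hy => intro s hs; rw [← mul_assoc]; exact hy _ (hx s hs)
  simpa using this 1 Sp_one

theorem Qs_zero {y : R} (hy : y ∈ Qs T U 0) : ∃ c, y = algebraMap (ZMod p) (R) c := by
  have : Qs T U 0 = ⊥ := by
    rw [Qs, eq_bot_iff]
    apply Algebra.adjoin_le
    rintro x ⟨α, hα, _⟩
    exact absurd (funext fun i => hα i (Nat.zero_le _)) α.2
  rw [this] at hy
  obtain ⟨c, hc⟩ := Algebra.mem_bot.1 hy
  exact ⟨c, hc.symm⟩

end spanning
section image
variable {p n : ℕ}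

theorem algMap_eq_cK (c : ZMod p) : algebraMap (ZMod p) (Kf p n) c = cK p n c := by
  rw [cK, IsScalarTower.algebraMap_apply (ZMod p) (MvPolynomial (Fin n) (ZMod p)) (Kf p n)]
  rfl

theorem algMapE_eq (c : ZMod p) :
    algebraMap (ZMod p) (Ef p n) c = algebraMap (Kf p n) (Ef p n) (cK p n c) := by
  rw [← algMap_eq_cK]; rfl

theorem zf_add (α β : Fin n → ZMod p) : zf p n (α + β) = zf p n α + zf p n β := by
  simp only [zf, cK, Pi.add_apply, map_add, add_mul, Finset.sum_add_distrib]

theorem zf_smul (k : ZMod p) (α : Fin n → ZMod p) : zf p n (k • α) = cK p n k * zf p n α := by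
  simp only [zf, cK, Pi.smul_apply, smul_eq_mul, map_mul, Finset.mul_sum, mul_assoc]

/-- coefficient vector of `dz_α` -/
def vK (p n : ℕ) (α : Fin n → ZMod p) : Fin n → Kf p n := fun i => cK p n (α i)

theorem vK_add (α β : Fin n → ZMod p) : vK p n (α + β) = vK p n α + vK p n β := by
  ext i; simp [vK, cK]

theorem vK_smul (k : ZMod p) (α : Fin n → ZMod p) : vK p n (k • α) = cK p n k • vK p n α := by
  ext i; simp [vK, cK]

theorem cK_zero : cK p n 0 = 0 := by simp [cK]

theorem cK_one : cK p n 1 = 1 := by simp [cK]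

variable [Fact (Nat.Prime p)]

theorem zf_inj : Function.Injective (zf p n) := by
  intro α β h
  have h1 : ∀ α : Fin n → ZMod p, zf p n α =
      algebraMap (MvPolynomial (Fin n) (ZMod p)) (Kf p n) (∑ i, C (α i) * X i) := by
    intro α
    simp only [zf, cK, xK, map_sum, map_mul]
  rw [h1, h1] at h
  have h2 := IsFractionRing.injective (MvPolynomial (Fin n) (ZMod p)) (Kf p n) h
  ext1 j
  have h3 := congrArg (coeff (Finsupp.single j 1)) h2
  simpa [coeff_sum, coeff_C_mul, coeff_X, Finsupp.single_left_inj] using h3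

theorem zf_zero : zf p n 0 = 0 := by simp [zf, cK]

theorem zf_ne (α : Nz p n) : zf p n α.1 ≠ 0 := fun h =>
  α.2 (zf_inj (h.trans zf_zero.symm))

theorem cK_ne (k : (ZMod p)ˣ) : cK p n (k : ZMod p) ≠ 0 := by
  rw [← algMap_eq_cK]
  simp

theorem dzf_eq (α : Fin n → ZMod p) : dzf p n α = ExteriorAlgebra.ι (Kf p n) (vK p n α) := by
  have : vK p n α = ∑ i, cK p n (α i) • (Pi.single i (1 : Kf p n) : Fin n → Kf p n) := by
    ext j; simp [vK, Finset.sum_apply, Pi.single_apply]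
  rw [this, map_sum]
  simp only [dzf, dxE, map_smul]
  simp only [Algebra.smul_def]

theorem uf_eq (α : Fin n → ZMod p) :
    uf p n α = tf p n α • ExteriorAlgebra.ι (Kf p n) (vK p n α) := by
  rw [uf, tE, dzf_eq, Algebra.smul_def]

theorem tf_sum (α β γ : Nz p n) (h : α.1 + β.1 + γ.1 = 0) :
    tf p n α.1 * tf p n β.1 + tf p n β.1 * tf p n γ.1 + tf p n γ.1 * tf p n α.1 = 0 := by
  have h1 := zf_add (α.1 + β.1) γ.1
  rw [h, zf_zero, zf_add] at h1
  have ha := zf_ne α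
  have hb := zf_ne β
  have hc := zf_ne γ
  simp only [tf]
  field_simp
  linear_combination -h1

theorem vK_sum (α β γ : Nz p n) (h : α.1 + β.1 + γ.1 = 0) :
    vK p n γ.1 = - vK p n α.1 - vK p n β.1 := by
  have h1 := vK_add (α.1 + β.1) γ.1
  rw [h, vK_add] at h1
  have h0 : vK p n 0 = 0 := by ext i; simp [vK, cK]
  rw [h0] at h1
  have h2 := eq_neg_of_add_eq_zero_right h1.symm
  rw [h2]; abel

theorem aux_utt {K M : Type*} [Field K] [AddCommGroup M] [Module K M] {a b c : K}
    (h : a * b + b * c + c * a = 0) (A B : M) :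
    (b * a) • A + (c * a) • A - (c * b) • B - (b * c) • (-A - B) = 0 := by
  have h2 : (a * b + b * c + c * a) • A = 0 := by rw [h, zero_smul]
  refine Eq.trans ?_ h2
  module

theorem E_data : PData p n (fun α : Nz p n => tE p n α.1) (fun α => uf p n α.1) where
  PT_comm α β := by simp only [tE, ← map_mul, mul_comm]
  PTU_comm α β := by simp only [tE]; exact Algebra.commutes _ _
  PUU_anti α β := by
    simp only [uf_eq, smul_mul_smul_comm]
    rw [ι_swap, smul_neg, mul_comm]
  PU_sq α := by
    simp only [uf_eq, smul_mul_smul_comm, ExteriorAlgebra.ι_sq_zero, smul_zero]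
  PT_scalar k α := by
    rw [algMapE_eq]
    simp only [tE, ← map_mul, tf, smNz, zf_smul]
    have h := cK_ne (n := n) k
    congr 1
    field_simp
  PU_scalar k α := by
    simp only [uf_eq, tf, smNz, zf_smul, vK_smul, map_smul, smul_smul]
    have h := cK_ne (n := n) k
    congr 1
    field_simp
  P_ttt α β γ h := by
    simp only [tE, ← map_mul, ← map_add, tf_sum α β γ h, map_zero]
  P_utt α β γ h := by
    have h1 := tf_sum α β γ h
    simp only [uf_eq, tE, ← Algebra.commutes, ← Algebra.smul_def, smul_smul, vK_sum α β γ h,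
      map_sub, map_neg]
    exact aux_utt h1 _ _
  P_uuu α β γ h := by
    have h1 := tf_sum α β γ h
    have e : ∀ a b : Fin n → Kf p n, ExteriorAlgebra.ι (Kf p n) b *
        (-ExteriorAlgebra.ι (Kf p n) a - ExteriorAlgebra.ι (Kf p n) b) =
        ExteriorAlgebra.ι (Kf p n) a * ExteriorAlgebra.ι (Kf p n) b := fun a b => by
      rw [mul_sub, mul_neg, ExteriorAlgebra.ι_sq_zero, sub_zero, ι_swap b a, neg_neg]
    have e' : ∀ a b : Fin n → Kf p n, 
        (-ExteriorAlgebra.ι (Kf p n) a - ExteriorAlgebra.ι (Kf p n) b) * 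
          ExteriorAlgebra.ι (Kf p n) a =
        ExteriorAlgebra.ι (Kf p n) a * ExteriorAlgebra.ι (Kf p n) b := fun a b => by
      rw [sub_mul, neg_mul, ExteriorAlgebra.ι_sq_zero, neg_zero, zero_sub, ι_swap b a, neg_neg]
    simp only [uf_eq, smul_mul_smul_comm, vK_sum α β γ h, map_sub, map_neg, e, e', ← add_smul, h1,
      zero_smul]

/-- subfield generated by the first `m` variables -/
def Fm (p n m : ℕ) [Fact (Nat.Prime p)] : Subfield (Kf p n) :=
  (IntermediateField.adjoin (ZMod p) (xK p n '' {i | i.1 < m})).toSubfield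

theorem Fm_trans (m : ℕ) (hm : m < n) : Transcendental (Fm p n m) (xK p n ⟨m, hm⟩) := by
  have h1 : AlgebraicIndependent (ZMod p) (xK p n) :=
    (MvPolynomial.algebraicIndependent_X (Fin n) (ZMod p)).map'
      (f := IsScalarTower.toAlgHom (ZMod p) (MvPolynomial (Fin n) (ZMod p)) (Kf p n))
      (IsFractionRing.injective (MvPolynomial (Fin n) (ZMod p)) (Kf p n))
  have h2 := h1.transcendental_adjoin (s := {i | i.1 < m}) (i := ⟨m, hm⟩) (by simp)
  exact IntermediateField.transcendental_adjoin_iff.2 h2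

theorem cK_mem (m : ℕ) (c : ZMod p) : cK p n c ∈ Fm p n m := by
  rw [← algMap_eq_cK]
  exact (IntermediateField.adjoin (ZMod p) (xK p n '' {i | i.1 < m})).algebraMap_mem c

theorem xK_mem (m : ℕ) (i : Fin n) (hi : i.1 < m) : xK p n i ∈ Fm p n m :=
  IntermediateField.subset_adjoin (ZMod p) _ ⟨i, hi, rfl⟩

theorem zf_mem (m : ℕ) (α : Fin n → ZMod p) (hα : ∀ i : Fin n, m ≤ i.1 → α i = 0) :
    zf p n α ∈ Fm p n m := by
  apply sum_mem
  intro i _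
  by_cases hi : i.1 < m
  · exact mul_mem (cK_mem m _) (xK_mem m i hi)
  · rw [hα i (not_lt.1 hi), cK_zero, zero_mul]; exact zero_mem _

theorem vK_mem (m : ℕ) (α : Fin n → ZMod p) (j : Fin n) : vK p n α j ∈ Fm p n m := cK_mem m _

theorem good_image {R : Type} [Ring R] [Algebra (ZMod p) R] {T U : Nz p n → R}
    (f : R →ₐ[ZMod p] Ef p n) (hT : ∀ α, f (T α) = tE p n α.1) (hU : ∀ α, f (U α) = uf p n α.1)
    (m : ℕ) {y : R} (hy : y ∈ Qs T U m) : GoodE (Fm p n m) m (f y) := by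
  have hs : ∀ (b : Ef p n) (r : Kf p n), b * algebraMap (Kf p n) (Ef p n) r = r • b := fun b r => by
    rw [← Algebra.commutes, Algebra.smul_def]
  have : ∀ b : Ef p n, GoodE (Fm p n m) m b → GoodE (Fm p n m) m (b * f y) := by
    induction hy using Algebra.adjoin_induction with
    | mem x hx =>
      intro b hb
      obtain ⟨α, hα, rfl | rfl⟩ := hx
      · rw [hT, tE, hs]
        exact hb.smul (inv_mem (zf_mem m _ hα))
      · rw [hU, uf_eq, mul_smul_comm]
        refine GoodE.smul (hb.mul_ι (vK_mem m _) ?_) (inv_mem (zf_mem m _ hα))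
        intro j hj
        rw [vK, hα j hj, cK_zero]
    | algebraMap r =>
      intro b hb
      rw [AlgHom.commutes, algMapE_eq, hs]
      exact hb.smul (cK_mem m r)
    | add x y _ _ hx hy => intro b hb; rw [map_add, mul_add]; exact (hx b hb).add (hy b hb)
    | mul x y _ _ hx hy => intro b hb; rw [map_mul, ← mul_assoc]; exact hy _ (hx b hb)
  simpa using this 1 GoodE.one

/-- lower part of a normalised vector -/
def lowPart {m : ℕ} {hm : m < n} (α : Lv p n m hm) : Fin n → ZMod p :=
  α.1.1 - Pi.single ⟨m, hm⟩ 1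

theorem lowPart_low {m : ℕ} {hm : m < n} (α : Lv p n m hm) (i : Fin n) (hi : m ≤ i.1) :
    lowPart α i = 0 := by
  obtain ⟨α, h1, h2⟩ := α
  by_cases h : i = ⟨m, hm⟩
  · subst h; simp [lowPart, h1]
  · have : m < i.1 := lt_of_le_of_ne hi (fun h' => h (Fin.ext h'.symm))
    simp [lowPart, h2 i this, h]

theorem zf_single (j : Fin n) : zf p n (Pi.single j 1) = xK p n j := by
  rw [zf, Finset.sum_eq_single j]
  · simp [cK_one]
  · intro i _ hi; simp [hi, cK_zero]
  · simp

theorem level_indep (m : ℕ) (hm : m < n) :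
    LinearIndependent (Fm p n m) (fun i : Option (Lv p n m hm × ℕ) =>
      i.elim (1 : Kf p n) (fun q => tf p n q.1.1.1 ^ (q.2 + 1))) := by
  have h := pf_indep (xK p n ⟨m, hm⟩) (Fm_trans m hm)
    (fun α : Lv p n m hm => (⟨zf p n (lowPart α), zf_mem m _ (lowPart_low α)⟩ : Fm p n m)) (by
      intro α β h
      have h1 := zf_inj (congrArg Subtype.val h)
      exact Subtype.ext (Subtype.ext (sub_left_injective h1)))
  have e : ∀ α : Lv p n m hm, tf p n α.1.1 = (xK p n ⟨m, hm⟩ + algebraMap (Fm p n m) (Kf p n)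
      ⟨zf p n (lowPart α), zf_mem m _ (lowPart_low α)⟩)⁻¹ := by
    intro α
    rw [tf, ← zf_single]
    change _ = (_ + zf p n (lowPart α))⁻¹
    rw [← zf_add]
    congr 2
    simp [lowPart]
  simp only [e]
  exact h

theorem inj_level {R : Type} [Ring R] [Algebra (ZMod p) R] {T U : Nz p n → R}
    (H : PData p n T U)
    (f : R →ₐ[ZMod p] Ef p n) (hT : ∀ α, f (T α) = tE p n α.1) (hU : ∀ α, f (U α) = uf p n α.1)
    (m : ℕ) (hm : m ≤ n) : ∀ y ∈ Qs T U m, f y = 0 → y = 0 := by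
  induction m with
  | zero =>
    intro y hy h0
    obtain ⟨c, rfl⟩ := Qs_zero hy
    rw [AlgHom.commutes, algMapE_eq, ← algMap_eq_cK] at h0
    have h1 : algebraMap (ZMod p) (Kf p n) c = 0 :=
      (ExteriorAlgebra.algebraMap_eq_zero_iff _ _).1 h0
    have h2 : c = 0 := (map_eq_zero _).1 h1
    rw [h2, map_zero]
  | succ m ih =>
    intro y hy h0
    have hm' : m < n := hm
    have hmem : y ∈ Sp T U m hm' := Qs_succ_le H hy
    rw [Sp, Submodule.span_union, Submodule.mem_sup] at hmem
    obtain ⟨y1, hy1, y2, hy2, rfl⟩ := hmem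
    obtain ⟨q, rfl⟩ := Finsupp.mem_span_range_iff_exists_finsupp.1 hy1
    obtain ⟨r, rfl⟩ := Finsupp.mem_span_range_iff_exists_finsupp.1 hy2
    let φ : Qs T U m →+ Ef p n := ((f : R →+* Ef p n).comp (Qs T U m).subtype).toAddMonoidHom
    have hφ : ∀ a : Qs T U m, φ a = f a.1 := fun a => rfl
    have hinj : ∀ a : Qs T U m, φ a = 0 → a = 0 := fun a h =>
      Subtype.ext (ih hm'.le a.1 a.2 h)
    have key := key_indep hm' _ (level_indep (p := p) (n := n) m hm') (fun i => vK p n i.1.1.1)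
      (fun i => by rw [vK, i.1.2.1, cK_one])
      (q.mapRange φ (map_zero φ)) (r.mapRange φ (map_zero φ))
      (fun i => good_image f hT hU m (q i).2) (fun i => good_image f hT hU m (r i).2) (by
        rw [Finsupp.sum_mapRange_index (by simp), Finsupp.sum_mapRange_index (by simp), ← h0,
          map_add]
        simp only [Finsupp.sum, map_sum]
        congr 1
        · refine Finset.sum_congr rfl fun i _ => ?_
          rw [Subalgebra.smul_def, smul_eq_mul, map_mul, hφ]
          congr 1
          rcases i with _ | ⟨α, k⟩
          · simp [bT]
          · simp [bT, hT, tE]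
        · refine Finset.sum_congr rfl fun i _ => ?_
          rw [Subalgebra.smul_def, smul_eq_mul, map_mul, hφ]
          congr 1
          simp only [bU, map_mul, map_pow, hT, hU, uf_eq, Option.elim_some, tE,
            Algebra.smul_def, pow_succ, mul_assoc])
    have hq : q = 0 := by
      ext1 i
      exact hinj _ (by simpa using DFunLike.congr_fun key.1 i)
    have hr : r = 0 := by
      ext1 i
      exact hinj _ (by simpa using DFunLike.congr_fun key.2 i)
    rw [hq, hr]
    simp

end image
section final
variable {p n : ℕ}

theorem P_data : PData p n (R := Pf p n) (TP p n) (UP p n) where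
  PT_comm α β := by
    have h := RingQuot.mkAlgHom_rel (ZMod p) (PRel.t_comm (p := p) (n := n) α β)
    simp only [map_mul] at h
    exact h
  PTU_comm α β := by
    have h := RingQuot.mkAlgHom_rel (ZMod p) (PRel.tu_comm (p := p) (n := n) α β)
    simp only [map_mul] at h
    exact h
  PUU_anti α β := by
    have h := RingQuot.mkAlgHom_rel (ZMod p) (PRel.u_anticomm (p := p) (n := n) α β)
    simp only [map_mul, map_neg] at h
    exact h
  PU_sq α := by
    have h := RingQuot.mkAlgHom_rel (ZMod p) (PRel.u_sq (p := p) (n := n) α)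
    simp only [map_mul, map_zero] at h
    exact h
  PT_scalar k α := by
    have h := RingQuot.mkAlgHom_rel (ZMod p) (PRel.t_scalar (p := p) (n := n) k α)
    simp only [map_mul, AlgHom.commutes] at h
    exact h
  PU_scalar k α := RingQuot.mkAlgHom_rel (ZMod p) (PRel.u_scalar (p := p) (n := n) k α)
  P_ttt α β γ h := by
    have h := RingQuot.mkAlgHom_rel (ZMod p) (PRel.ttt (p := p) (n := n) α β γ h)
    simp only [map_mul, map_zero, map_add] at h
    exact h
  P_utt α β γ h := by
    have h := RingQuot.mkAlgHom_rel (ZMod p) (PRel.utt (p := p) (n := n) α β γ h)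
    simp only [map_mul, map_zero, map_add, map_sub] at h
    exact h
  P_uuu α β γ h := by
    have h := RingQuot.mkAlgHom_rel (ZMod p) (PRel.uuu (p := p) (n := n) α β γ h)
    simp only [map_mul, map_zero, map_add] at h
    exact h

theorem Qs_top (y : Pf p n) : y ∈ Qs (TP p n) (UP p n) n := by
  obtain ⟨x, rfl⟩ := RingQuot.mkAlgHom_surjective (ZMod p) (PRel p n) y
  induction x using FreeAlgebra.induction with
  | grade0 r => rw [AlgHom.commutes]; exact Subalgebra.algebraMap_mem _ r
  | grade1 x =>
    rcases x with α | α
    · exact Algebra.subset_adjoin ⟨α, fun i hi => absurd i.2 (by omega), Or.inl rfl⟩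
    · exact Algebra.subset_adjoin ⟨α, fun i hi => absurd i.2 (by omega), Or.inr rfl⟩
  | mul a b ha hb => rw [map_mul]; exact Subalgebra.mul_mem _ ha hb
  | add a b ha hb => rw [map_add]; exact Subalgebra.add_mem _ ha hb

theorem exists_hom (p n : ℕ) [Fact (Nat.Prime p)] : ∃ f : Pf p n →ₐ[ZMod p] Ef p n,
      (∀ α : Nz p n, f (TP p n α) = tE p n α.1) ∧
      (∀ α : Nz p n, f (UP p n α) = uf p n α.1) := by
  let g : FA p n →ₐ[ZMod p] Ef p n := FreeAlgebra.lift (ZMod p)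
    (Sum.elim (fun α : Nz p n => tE p n α.1) (fun α => uf p n α.1))
  have gT : ∀ α, g (Tg p n α) = tE p n α.1 := fun α => by simp [g, Tg]
  have gU : ∀ α, g (Ug p n α) = uf p n α.1 := fun α => by simp [g, Ug]
  have H := E_data (p := p) (n := n)
  have hg : ∀ ⦃x y : FA p n⦄, PRel p n x y → g x = g y := by
    intro x y h
    induction h with
    | t_comm α β => simp only [map_mul, gT]; exact H.PT_comm α β
    | tu_comm α β => simp only [map_mul, gT, gU]; exact H.PTU_comm α β
    | u_anticomm α β => simp only [map_mul, map_neg, gU]; exact H.PUU_anti α β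
    | u_sq α => simp only [map_mul, map_zero, gU]; exact H.PU_sq α
    | t_scalar k α => simp only [map_mul, AlgHom.commutes, gT]; exact H.PT_scalar k α
    | u_scalar k α => simp only [gU]; exact H.PU_scalar k α
    | ttt α β γ h => simp only [map_mul, map_zero, map_add, gT]; exact H.P_ttt α β γ h
    | utt α β γ h =>
      simp only [map_mul, map_zero, map_add, map_sub, gT, gU]; exact H.P_utt α β γ h
    | uuu α β γ h => simp only [map_mul, map_zero, map_add, gU]; exact H.P_uuu α β γ h
  refine ⟨RingQuot.liftAlgHom (ZMod p) ⟨g, hg⟩, fun α => ?_, fun α => ?_⟩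
  · rw [TP, RingQuot.liftAlgHom_mkAlgHom_apply, gT]
  · rw [UP, RingQuot.liftAlgHom_mkAlgHom_apply, gU]

end final

/-- The `𝔽_p`-algebra homomorphism `P → E` determined by `T_α ↦ t_α` and `U_α ↦ u_α`
is well defined (and unique), injective, and its image is exactly `A`; in particular
`P` is isomorphic as an `𝔽_p`-algebra to the subalgebra `A` of `E`. -/
theorem stmt4 (p n : ℕ) [Fact (Nat.Prime p)] (hodd : Odd p) (hn : 1 ≤ n) :
    (∃ f : Pf p n →ₐ[ZMod p] Ef p n,
      (∀ α : Nz p n, f (TP p n α) = tE p n α.1) ∧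
      (∀ α : Nz p n, f (UP p n α) = uf p n α.1) ∧
      Function.Injective f ∧
      f.range = Af p n ∧
      (∀ g : Pf p n →ₐ[ZMod p] Ef p n,
        (∀ α : Nz p n, g (TP p n α) = tE p n α.1) →
        (∀ α : Nz p n, g (UP p n α) = uf p n α.1) → g = f)) ∧
    Nonempty (Pf p n ≃ₐ[ZMod p] Af p n) := by
  obtain ⟨f, hT, hU⟩ := exists_hom p n
  have huniq : ∀ g : Pf p n →ₐ[ZMod p] Ef p n,
        (∀ α : Nz p n, g (TP p n α) = tE p n α.1) →
        (∀ α : Nz p n, g (UP p n α) = uf p n α.1) → g = f := by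
    intro g hgT hgU
    apply RingQuot.ringQuot_ext'
    apply FreeAlgebra.hom_ext
    funext x
    rcases x with α | α
    · exact (hgT α).trans (hT α).symm
    · exact (hgU α).trans (hU α).symm
  have hinj : Function.Injective f :=
    (injective_iff_map_eq_zero f).2 fun y h0 => inj_level P_data f hT hU n le_rfl y (Qs_top y) h0
  have hrange : f.range = Af p n := by
    apply le_antisymm
    · rintro _ ⟨y, rfl⟩
      have hy : y ∈ Qs (TP p n) (UP p n) n := Qs_top y
      change f y ∈ Af p n
      induction hy using Algebra.adjoin_induction with
      | mem x hx =>
        obtain ⟨α, _, rfl | rfl⟩ := hx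
        · rw [hT]; exact Algebra.subset_adjoin ⟨α.1, α.2, Or.inl rfl⟩
        · rw [hU]; exact Algebra.subset_adjoin ⟨α.1, α.2, Or.inr rfl⟩
      | algebraMap r => rw [AlgHom.commutes]; exact Subalgebra.algebraMap_mem _ r
      | add x y _ _ hx hy => rw [map_add]; exact Subalgebra.add_mem _ hx hy
      | mul x y _ _ hx hy => rw [map_mul]; exact Subalgebra.mul_mem _ hx hy
    · apply Algebra.adjoin_le
      rintro x ⟨α, hα, rfl | rfl⟩
      · exact ⟨TP p n ⟨α, hα⟩, hT ⟨α, hα⟩⟩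
      · exact ⟨UP p n ⟨α, hα⟩, hU ⟨α, hα⟩⟩
  refine ⟨⟨f, hT, hU, hinj, hrange, huniq⟩, ⟨?_⟩⟩
  exact (AlgEquiv.ofInjective f hinj).trans (Subalgebra.equivOfEq _ _ hrange)

end
end

section
/- Let p be an odd prime and n ≥ 1, and fix any linear order on 𝔽_p^n. The family of elements Π_{α ∈ S} t_α^{m(α)}·u_α^{ε(α)} of E (the product taken in increasing order of α), indexed by triples (S, m, ε) where S ∈ F_n, m : S → ℕ, ε : S → {0,1}, and m(α) + ε(α) ≥ 1 for every α ∈ S, is an 𝔽_p-vector space basis of the subalgebra A. -/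
open MvPolynomial

set_option synthInstance.maxHeartbeats 1000000
set_option maxHeartbeats 1000000

noncomputable section

/-- The collection `F_n` of finite subsets of `𝔽_p^n ∖ {0}`, defined recursively by
`F_0 = {∅}` (so that `F_1 = {∅, {(1)}}`) and
`F_n = F_{n−1} ∪ {S ∪ {x} : S ∈ F_{n−1}, x ∈ 𝔽_p^{n−1}×{1}}`, where `F_{n−1}` is regarded
inside `𝔽_p^n` via the embedding `𝔽_p^{n−1}×{0}`. -/
def Fn (p : ℕ) : (n : ℕ) → Set (Finset (Fin n → ZMod p))
  | 0 => {∅}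
  | n + 1 =>
      (fun S : Finset (Fin n → ZMod p) =>
          S.image fun v => Fin.snoc v (0 : ZMod p)) '' Fn p n ∪
        {T | ∃ S ∈ Fn p n, ∃ x : Fin n → ZMod p,
          T = (S.image fun v => Fin.snoc v (0 : ZMod p)) ∪ {Fin.snoc x (1 : ZMod p)}}

/-- The index set of the basis: triples `(S, m, ε)` with `S ∈ F_n`, `m : S → ℕ`,
`ε : S → {0,1}` (encoded as functions on `𝔽_p^n` supported on `S`), such that
`m(α) + ε(α) ≥ 1` for every `α ∈ S`. -/
def Idx6 (p n : ℕ) : Type _ :=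
  {x : Finset (Fin n → ZMod p) × ((Fin n → ZMod p) → ℕ) × ((Fin n → ZMod p) → Bool) //
    x.1 ∈ Fn p n ∧
      (∀ α ∈ x.1, 1 ≤ x.2.1 α + (if x.2.2 α then 1 else 0)) ∧
      ∀ α ∉ x.1, x.2.1 α = 0 ∧ x.2.2 α = false}

/-- The monomial `Π_{α ∈ S} t_α^{m(α)}·u_α^{ε(α)}` in `E`, the product taken in
increasing order of `α` with respect to the fixed linear order `r`. -/
def monFam (p n : ℕ) [Fact (Nat.Prime p)] (r : LinearOrder (Fin n → ZMod p))
    (x : Idx6 p n) : Ef p n :=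
  letI := r
  ((x.1.1.sort (· ≤ ·)).map fun α =>
    tE p n α ^ x.1.2.1 α * uf p n α ^ (if x.1.2.2 α then 1 else 0)).prod

set_option linter.unusedSectionVars false
namespace S6

/-- elements of `K` regular at `x = -b` -/
def Good {L K : Type*} [Field L] [Field K] [Algebra L K] (x : K) (b : L) (v : K) : Prop :=
  ∃ f g : Polynomial L, g.eval (-b) ≠ 0 ∧ v * Polynomial.aeval x g = Polynomial.aeval x f

section
variable {L K : Type*} [Field L] [Field K] [Algebra L K] {x : K} {b : L}

theorem Good.one : Good x b (1 : K) := ⟨1, 1, by simp, by simp⟩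

theorem Good.zero : Good x b (0 : K) := ⟨0, 1, by simp, by simp⟩

theorem Good.add {v w : K} (hv : Good x b v) (hw : Good x b w) : Good x b (v + w) := by
  obtain ⟨f, g, hg, h⟩ := hv
  obtain ⟨f', g', hg', h'⟩ := hw
  refine ⟨f * g' + f' * g, g * g', by simp [hg, hg'], ?_⟩
  simp only [map_mul, map_add, ← h, ← h']
  ring

theorem Good.mul {v w : K} (hv : Good x b v) (hw : Good x b w) : Good x b (v * w) := by
  obtain ⟨f, g, hg, h⟩ := hv
  obtain ⟨f', g', hg', h'⟩ := hw
  refine ⟨f * f', g * g', by simp [hg, hg'], ?_⟩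
  simp only [map_mul, ← h, ← h']
  ring

theorem Good.pow {v : K} (hv : Good x b v) (m : ℕ) : Good x b (v ^ m) := by
  induction m with
  | zero => simpa using Good.one
  | succ m ih => rw [pow_succ]; exact ih.mul hv

theorem Good.sum {ι : Type*} (s : Finset ι) (f : ι → K) (h : ∀ i ∈ s, Good x b (f i)) :
    Good x b (∑ i ∈ s, f i) := by
  classical
  induction s using Finset.induction_on with
  | empty => simpa using Good.zero
  | insert i s hi ih =>
    rw [Finset.sum_insert hi]
    exact (h i (by simp)).add (ih fun j hj => h j (by simp [hj]))

theorem Good.const (c : L) : Good x b (algebraMap L K c) :=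
  ⟨Polynomial.C c, 1, by simp, by simp⟩

theorem Good.lin (a : L) : Good x b (x + algebraMap L K a) :=
  ⟨Polynomial.X + Polynomial.C a, 1, by simp, by simp⟩

theorem lin_ne_zero (hx : Transcendental L x) (a : L) : x + algebraMap L K a ≠ 0 := by
  intro h
  apply hx
  refine ⟨Polynomial.X + Polynomial.C a, Polynomial.X_add_C_ne_zero a, by simpa using h⟩

theorem Good.inv (hx : Transcendental L x) {a : L} (h : a ≠ b) :
    Good x b (x + algebraMap L K a)⁻¹ :=
  ⟨1, Polynomial.X + Polynomial.C a, by
    simp only [Polynomial.eval_add, Polynomial.eval_X, Polynomial.eval_C]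
    intro h'
    exact h (by linear_combination h'), by
    simp [inv_mul_cancel₀ (lin_ne_zero hx a)]⟩

theorem Good.const_eq_zero (hx : Transcendental L x) {c : L} {v : K} (hv : Good x b v)
    (h : algebraMap L K c = (x + algebraMap L K b) * v) : c = 0 := by
  obtain ⟨f, g, hg, hfg⟩ := hv
  have h1 : Polynomial.aeval x (Polynomial.C c * g - (Polynomial.X + Polynomial.C b) * f) = 0 := by
    simp only [map_sub, map_mul, map_add, Polynomial.aeval_C, Polynomial.aeval_X, ← hfg, h]
    ring
  have h2 : Polynomial.C c * g - (Polynomial.X + Polynomial.C b) * f = 0 := by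
    by_contra hne
    exact hx ⟨_, hne, h1⟩
  have h3 := congrArg (Polynomial.eval (-b)) h2
  simpa [hg] using h3

/-- the partial fraction family -/
def pf {L K I : Type*} [Field L] [Field K] [Algebra L K] (x : K) (a : I → L) :
    Option (I × ℕ) → K
  | none => 1
  | some (i, m) => (x + algebraMap L K (a i))⁻¹ ^ (m + 1)

theorem pf_linearIndependent {I : Type*} (hx : Transcendental L x) (a : I → L)
    (ha : Function.Injective a) : LinearIndependent L (pf x a) := by
  classical
  rw [linearIndependent_iff'']
  intro s g hg hsum
  have key : ∀ i m, g (some (i, m)) = 0 := by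
    intro i m
    by_contra hne
    have hmem : ∀ m, g (some (i, m)) ≠ 0 → some (i, m) ∈ s := fun m h => by
      by_contra h'
      exact h (hg _ h')
    have hfin : {m | g (some (i, m)) ≠ 0}.Finite := by
      refine Set.Finite.of_injOn (f := fun m => some (i, m)) (t := (s : Set _)) ?_ ?_ s.finite_toSet
      · intro m hm; exact hmem m hm
      · intro m _ m' _ h; simpa using h
    obtain ⟨M, hM, hmax⟩ := Set.exists_max_image _ (fun m => m) hfin ⟨m, hne⟩
    rw [← Finset.add_sum_erase s _ (hmem M hM)] at hsum
    have hlin := lin_ne_zero hx (a i)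
    set y := x + algebraMap L K (a i) with hy
    have hgood : Good x (a i) (y ^ M * ∑ o ∈ s.erase (some (i, M)), g o • pf x a o) := by
      rw [Finset.mul_sum]
      refine Good.sum _ _ fun o ho => ?_
      rw [Finset.mem_erase] at ho
      rcases o with _ | ⟨j, k⟩
      · simp only [pf, Algebra.smul_def, mul_one]
        exact ((Good.lin _).pow _).mul (Good.const _)
      · by_cases hj : j = i
        · subst hj
          by_cases h0 : g (some (j, k)) = 0
          · simp only [h0, zero_smul, mul_zero]; exact Good.zero
          · have hk : k ≤ M := hmax k h0
            have hk' : k < M := lt_of_le_of_ne hk fun h => ho.1 (by rw [h])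
            have : y ^ M * g (some (j, k)) • pf x a (some (j, k)) =
                algebraMap L K (g (some (j, k))) * y ^ (M - (k + 1)) := by
              simp only [pf, Algebra.smul_def, ← hy]
              rw [← Nat.sub_add_cancel (show k + 1 ≤ M from hk'), pow_add, inv_pow,
                Nat.add_sub_cancel]
              field_simp
            rw [this]
            exact (Good.const _).mul ((Good.lin _).pow _)
        · simp only [pf, Algebra.smul_def]
          exact ((Good.lin _).pow _).mul
            ((Good.const _).mul ((Good.inv hx fun h => hj (ha h)).pow _))
    refine hM (Good.const_eq_zero hx ((Good.const (-1)).mul hgood) (?_ : _ = y * _))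
    have e : pf x a (some (i, M)) = y⁻¹ ^ (M + 1) := rfl
    rw [e, Algebra.smul_def] at hsum
    have : algebraMap L K (g (some (i, M))) =
        y ^ (M + 1) * (algebraMap L K (g (some (i, M))) * y⁻¹ ^ (M + 1)) := by
      rw [inv_pow]; field_simp
    rw [this, eq_neg_of_add_eq_zero_left hsum]
    simp
    ring
  rintro (_ | ⟨i, m⟩)
  · by_cases hs : none ∈ s
    · rw [Finset.sum_eq_single_of_mem none hs] at hsum
      · simpa [pf, Algebra.smul_def] using hsum
      · rintro (_ | ⟨i, m⟩) _ h
        · exact absurd rfl h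
        · simp [key]
    · exact hg _ hs
  · exact key i m
end

/-! ### the abstract setting -/

/-- recursive index type -/
def J (p : ℕ) : ℕ → Type
  | 0 => Unit
  | k + 1 => J p k × Option ((Fin k → ZMod p) × ℕ × Bool)

section
variable (p : ℕ) [Fact p.Prime] {K E : Type*} [Field K] [Ring E] [Algebra (ZMod p) K]
  [Algebra K E] [Algebra (ZMod p) E] [IsScalarTower (ZMod p) K E] (x : ℕ → K) (d : ℕ → E)

def zz (k : ℕ) (v : Fin k → ZMod p) : K := ∑ i, algebraMap (ZMod p) K (v i) * x i
def dd (k : ℕ) (v : Fin k → ZMod p) : E := ∑ i, algebraMap (ZMod p) E (v i) * d i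
def tt (E : Type*) [Ring E] [Algebra K E] (k : ℕ) (v : Fin k → ZMod p) : E :=
  algebraMap K E (zz p x k v)⁻¹
def uu (k : ℕ) (v : Fin k → ZMod p) : E := tt p x E k v * dd p d k v

def wt (k : ℕ) : Option ((Fin k → ZMod p) × ℕ × Bool) → E
  | none => 1
  | some (α, m, false) => tt p x E (k + 1) (Fin.snoc α 1) ^ (m + 1)
  | some (α, m, true) =>
      tt p x E (k + 1) (Fin.snoc α 1) ^ m * uu p x d (k + 1) (Fin.snoc α 1)

def can : (k : ℕ) → J p k → E
  | 0, _ => 1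
  | k + 1, j => can k j.1 * wt p x d k j.2

theorem zz_snoc (k : ℕ) (v : Fin k → ZMod p) (a : ZMod p) :
    zz p x (k + 1) (Fin.snoc v a) = zz p x k v + algebraMap (ZMod p) K a * x k := by
  simp [zz, Fin.sum_univ_castSucc]

theorem dd_snoc (k : ℕ) (v : Fin k → ZMod p) (a : ZMod p) :
    dd p d (k + 1) (Fin.snoc v a) = dd p d k v + algebraMap (ZMod p) E a * d k := by
  simp [dd, Fin.sum_univ_castSucc]

theorem zz_snoc_zero (k : ℕ) (v : Fin k → ZMod p) :
    zz p x (k + 1) (Fin.snoc v 0) = zz p x k v := by simp [zz_snoc]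

theorem tt_snoc_zero (k : ℕ) (v : Fin k → ZMod p) :
    tt p x E (k + 1) (Fin.snoc v 0) = tt p x E k v := by simp [tt, zz_snoc_zero]

theorem uu_snoc_zero (k : ℕ) (v : Fin k → ZMod p) :
    uu p x d (k + 1) (Fin.snoc v 0) = uu p x d k v := by simp [uu, tt_snoc_zero, dd_snoc]

theorem zz_sub (k : ℕ) (v w : Fin k → ZMod p) :
    zz p x k (v - w) = zz p x k v - zz p x k w := by
  simp [zz, sub_mul, Finset.sum_sub_distrib]

theorem zz_smul (k : ℕ) (c : ZMod p) (v : Fin k → ZMod p) :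
    zz p x k (c • v) = algebraMap (ZMod p) K c * zz p x k v := by
  simp [zz, Finset.mul_sum, mul_assoc]

theorem dd_sub (k : ℕ) (v w : Fin k → ZMod p) :
    dd p d k (v - w) = dd p d k v - dd p d k w := by
  simp [dd, sub_mul, Finset.sum_sub_distrib]

theorem dd_smul (k : ℕ) (c : ZMod p) (v : Fin k → ZMod p) :
    dd p d k (c • v) = algebraMap (ZMod p) E c * dd p d k v := by
  simp [dd, Finset.mul_sum, mul_assoc]

/-- The subfield generated by the first `k` variables. -/
def KK (k : ℕ) : IntermediateField (ZMod p) K := IntermediateField.adjoin (ZMod p) (x '' Set.Iio k)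

theorem zz_mem (k : ℕ) (v : Fin k → ZMod p) : zz p x k v ∈ KK p x k := by
  refine sum_mem fun i _ => mul_mem (IntermediateField.algebraMap_mem _ _) ?_
  exact IntermediateField.subset_adjoin _ _ ⟨i, i.2, rfl⟩

theorem KK_le (k : ℕ) : KK p x k ≤ KK p x (k + 1) := by
  apply IntermediateField.adjoin.mono
  apply Set.image_mono
  intro i hi
  exact Nat.lt_succ_of_lt hi

theorem zz_ne_zero {N : ℕ} (hx : ∀ k < N, Transcendental (KK p x k) (x k)) :
    ∀ k ≤ N, ∀ v : Fin k → ZMod p, v ≠ 0 → zz p x k v ≠ 0 := by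
  intro k
  induction k with
  | zero => intro _ v hv; exact absurd (Subsingleton.elim _ _) hv
  | succ k ih =>
    intro hk v hv h
    obtain ⟨w, a, rfl⟩ : ∃ w a, v = Fin.snoc w a := ⟨Fin.init v, v (Fin.last k), by simp⟩
    rw [zz_snoc] at h
    by_cases ha : a = 0
    · subst ha
      refine ih (by omega) w ?_ (by simpa using h)
      rintro rfl
      apply hv
      ext i
      refine Fin.lastCases ?_ (fun i => ?_) i <;> simp
    · apply hx k hk
      have ha' : algebraMap (ZMod p) K a ≠ 0 := by simpa using ha
      have h1 : x k = - (algebraMap (ZMod p) K a)⁻¹ * zz p x k w := by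
        field_simp
        linear_combination h
      have h2 : x k ∈ KK p x k := by
        rw [h1, ← map_inv₀]
        exact mul_mem (neg_mem (IntermediateField.algebraMap_mem _ _)) (zz_mem p x k w)
      exact isAlgebraic_algebraMap (⟨x k, h2⟩ : KK p x k)

theorem zz_injective {N : ℕ} (hx : ∀ k < N, Transcendental (KK p x k) (x k)) {k : ℕ}
    (hk : k ≤ N) : Function.Injective (zz p x k) := by
  intro v w h
  by_contra hne
  exact zz_ne_zero p x hx k hk (v - w) (sub_ne_zero.2 hne) (by rw [zz_sub, h, sub_self])

theorem tower_li {F : Type*} [Field F] [Algebra F K] {A B : IntermediateField F K} (h : A ≤ B)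
    {I O : Type*}
    (y : I → K) (q : O → K) (hq : ∀ o, q o ∈ B) (hqi : LinearIndependent A q)
    (hy : LinearIndependent B y) : LinearIndependent A (fun s : I × O => y s.1 * q s.2) := by
  let _ : Algebra A B := (IntermediateField.inclusion h).toAlgebra
  have : IsScalarTower A B K := IsScalarTower.of_algebraMap_eq fun _ => rfl
  let q' : O → B := fun o => ⟨q o, hq o⟩
  have h1 : LinearIndependent A q' := by
    refine LinearIndependent.of_comp ((IsScalarTower.toAlgHom A B K).toLinearMap) ?_
    exact hqi
  have h2 := linearIndependent_smul h1 hy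
  have h3 := h2.comp Prod.swap Prod.swap_injective
  convert h3 using 1
  ext s
  simp [q', Algebra.smul_def, mul_comm]

def aK (k : ℕ) (v : Fin k → ZMod p) : KK p x k := ⟨zz p x k v, zz_mem p x k v⟩

theorem pf_some (k : ℕ) (α : Fin k → ZMod p) (m : ℕ) :
    pf (x k) (aK p x k) (some (α, m)) = (zz p x (k + 1) (Fin.snoc α 1))⁻¹ ^ (m + 1) := by
  simp only [pf, zz_snoc, map_one, one_mul, add_comm]
  rfl

theorem pf_mem (k : ℕ) (o) : pf (x k) (aK p x k) o ∈ KK p x (k + 1) := by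
  rcases o with _ | ⟨α, m⟩
  · exact one_mem _
  · rw [pf_some]
    exact pow_mem (inv_mem (zz_mem _ _ _ _)) _

variable {p x d}

theorem D_tt {D : E →ₗ[K] E} {b : E} (hb : D b = 0) (k : ℕ) (v : Fin k → ZMod p) :
    D (b * tt p x E k v) = 0 := by
  rw [tt, ← Algebra.commutes, ← Algebra.smul_def, map_smul, hb, smul_zero]

theorem D_tt_pow {D : E →ₗ[K] E} {b : E} (hb : D b = 0) (k : ℕ) (v : Fin k → ZMod p) (m : ℕ) :
    D (b * tt p x E k v ^ m) = 0 := by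
  induction m with
  | zero => simpa using hb
  | succ m ih => rw [pow_succ, ← mul_assoc]; exact D_tt ih k v

theorem D_dd {D : E →ₗ[K] E} {k : ℕ} (hD : ∀ b, ∀ i < k, D (b * d i) = - D b * d i)
    {b : E} (hb : D b = 0) (v : Fin k → ZMod p) :
    D (b * dd p d k v) = 0 := by
  rw [dd, Finset.mul_sum, map_sum]
  refine Finset.sum_eq_zero fun i _ => ?_
  rw [← mul_assoc, hD _ _ i.2, IsScalarTower.algebraMap_apply (ZMod p) K E, ← Algebra.commutes,
    ← Algebra.smul_def, map_smul, hb]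
  simp

theorem D_can {D : E →ₗ[K] E} {k : ℕ} (hD : ∀ b, ∀ i < k, D (b * d i) = - D b * d i)
    (l : ℕ) (hl : l ≤ k) (j : J p l) {b : E} (hb : D b = 0) : D (b * can p x d l j) = 0 := by
  induction l generalizing b with
  | zero => simpa [can] using hb
  | succ l ih =>
    rw [can, ← mul_assoc]
    have h1 := ih (by omega) j.1 hb
    rcases j.2 with _ | ⟨α, m, _ | _⟩
    · simpa [wt] using h1
    · exact D_tt_pow h1 _ _ _
    · simp only [wt, uu, ← mul_assoc]
      exact D_dd (fun b i hi => hD b i (by omega)) (D_tt (D_tt_pow h1 _ _ _) _ _) _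

theorem tt_comm (k : ℕ) (v : Fin k → ZMod p) (b : E) : tt p x E k v * b = b * tt p x E k v :=
  Algebra.commutes _ _

/-- index rearrangement -/
def rearr {I V T : Type} : I × (T × Option (V × ℕ × Bool)) →
    ((I × Option (V × ℕ)) × T) ⊕ ((I × V × ℕ) × T)
  | (i, (j, none)) => Sum.inl ((i, none), j)
  | (i, (j, some (v, m, false))) => Sum.inl ((i, some (v, m)), j)
  | (i, (j, some (v, m, true))) => Sum.inr ((i, v, m), j)

theorem li_main {N : ℕ} (hx : ∀ k < N, Transcendental (KK p x k) (x k)) [Nontrivial E]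
    (D : ℕ → E →ₗ[K] E) (hD1 : ∀ k < N, D k 1 = 0)
    (hD : ∀ k < N, ∀ b, ∀ i < k, D k (b * d i) = - D k b * d i)
    (hDk : ∀ k < N, ∀ b, D k (b * d k) = b - D k b * d k) :
    ∀ k ≤ N, ∀ {I : Type} (y : I → K), LinearIndependent (KK p x k) y →
      LinearIndependent (ZMod p) (fun q : I × J p k => algebraMap K E (y q.1) * can p x d k q.2) := by
  intro k
  induction k with
  | zero =>
    intro _ I y hy
    have h1 : LinearIndependent (ZMod p) y := hy.restrict_scalars' (ZMod p)
    have h2 : LinearIndependent (ZMod p) (fun i => algebraMap K E (y i)) := by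
      refine h1.map' ((IsScalarTower.toAlgHom (ZMod p) K E).toLinearMap) ?_
      rw [LinearMap.ker_eq_bot]
      exact (algebraMap K E).injective
    have h3 := h2.comp (Prod.fst : I × J p 0 → I) (by
      rintro ⟨i, ⟨⟩⟩ ⟨i', ⟨⟩⟩ h; obtain rfl : i = i' := h; rfl)
    convert h3 using 1
    ext q
    simp [can]
  | succ k ih =>
    intro hk I y hy
    have hk' : k < N := hk
    have hy' : LinearIndependent (KK p x k)
        (fun s : I × Option ((Fin k → ZMod p) × ℕ) => y s.1 * pf (x k) (aK p x k) s.2) :=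
      tower_li (KK_le p x k) y _ (pf_mem p x k)
        (pf_linearIndependent (hx k hk') _ fun v w h =>
          zz_injective p x hx hk'.le (congrArg Subtype.val h)) hy
    have hA := ih hk'.le _ hy'
    -- the part with `u`
    let B : (I × (Fin k → ZMod p) × ℕ) × J p k → E := fun q =>
      algebraMap K E (y q.1.1) * (can p x d k q.2 * wt p x d k (some (q.1.2.1, q.1.2.2, true)))
    have hD0 : ∀ (c : K) (j : J p k), D k (algebraMap K E c * can p x d k j) = 0 := by
      intro c j
      refine D_can (hD k hk') k le_rfl j ?_
      rw [Algebra.algebraMap_eq_smul_one, map_smul, hD1 k hk', smul_zero]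
    have hDB : ∀ q, D k (B q) = algebraMap K E (y q.1.1 * pf (x k) (aK p x k)
        (some (q.1.2.1, q.1.2.2))) * can p x d k q.2 := by
      rintro ⟨⟨i, α, m⟩, j⟩
      simp only [B, wt, uu, dd_snoc, map_one, one_mul, ← mul_assoc, mul_add, map_add]
      have h0 := D_tt (x := x) (D_tt_pow (x := x) (hD0 (y i) j) (k + 1) (Fin.snoc α 1) m)
        (k + 1) (Fin.snoc α 1)
      rw [D_dd (hD k hk') h0, hDk k hk', h0, pf_some, mul_assoc _ _ (tt p x E _ _), ← pow_succ,
        zero_mul, sub_zero, zero_add, tt, ← map_pow, ← Algebra.commutes, map_mul, ← mul_assoc,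
        (Algebra.commutes (y i) (algebraMap K E _))]
    let Dl : E →ₗ[ZMod p] E := (D k).restrictScalars (ZMod p)
    have hDBli : LinearIndependent (ZMod p) (Dl ∘ B) := by
      have := hA.comp (fun q : (I × (Fin k → ZMod p) × ℕ) × J p k =>
        ((q.1.1, some q.1.2), q.2)) (by
          rintro ⟨⟨i, α⟩, j⟩ ⟨⟨i', α'⟩, j'⟩ h
          simpa using h)
      convert this using 1
      ext q
      exact hDB q
    have hBli : LinearIndependent (ZMod p) B := hDBli.of_comp
    have hdisj := Submodule.range_ker_disjoint hDBli
    have hsum := hA.sum_type hBli (by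
      refine (hdisj.mono_right ?_).symm
      rw [Submodule.span_le]
      rintro _ ⟨q, rfl⟩
      exact hD0 _ _)
    have hfin := hsum.comp (rearr (I := I) (V := Fin k → ZMod p) (T := J p k)) (by
      rintro ⟨i, j, _ | ⟨v, m, _ | _⟩⟩ ⟨i', j', _ | ⟨v', m', _ | _⟩⟩ h <;>
        simp_all [rearr])
    have e : (fun q : I × (J p k × Option ((Fin k → ZMod p) × ℕ × Bool)) =>
        algebraMap K E (y q.1) * can p x d (k + 1) q.2) = (Sum.elim (fun q : (I × Option
          ((Fin k → ZMod p) × ℕ)) × J p k => algebraMap K E (y q.1.1 * pf (x k) (aK p x k) q.1.2) *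
            can p x d k q.2) B) ∘ rearr := by
      ext ⟨i, j, _ | ⟨v, m, _ | _⟩⟩
      · simp [rearr, can, wt, pf]
      · simp only [Function.comp, rearr, Sum.elim_inl, can, wt, pf_some, map_mul]
        rw [tt, ← map_pow, ← Algebra.commutes, ← mul_assoc, Algebra.commutes (y i)]
      · rfl
    rw [← e] at hfin
    exact hfin

end

section
variable {p : ℕ} [Fact p.Prime] {K E : Type*} [Field K] [Ring E] [Algebra (ZMod p) K]
  [Algebra K E] [Algebra (ZMod p) E] [IsScalarTower (ZMod p) K E] {x : ℕ → K} {d : ℕ → E}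

theorem mR {A B C : Submodule (ZMod p) E} (h : B ≤ C) : A * B ≤ A * C := mul_le_mul' le_rfl h

theorem mL {A B C : Submodule (ZMod p) E} (h : B ≤ C) : B * A ≤ C * A := mul_le_mul' h le_rfl

theorem rel_scal {a b : K} (ha : a ≠ 0) (hb : b ≠ 0) (hab : a - b ≠ 0) :
    a⁻¹ * b⁻¹ = (a - b)⁻¹ * b⁻¹ - (a - b)⁻¹ * a⁻¹ := by
  field_simp

theorem rel_tt {a b : K} (ha : a ≠ 0) (hb : b ≠ 0) (hab : a - b ≠ 0) :
    algebraMap K E b⁻¹ * algebraMap K E a⁻¹ =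
      algebraMap K E (a - b)⁻¹ * algebraMap K E b⁻¹ -
        algebraMap K E (a - b)⁻¹ * algebraMap K E a⁻¹ := by
  simp only [← map_mul, ← map_sub]
  rw [← rel_scal ha hb hab, mul_comm]

theorem rel_tu {a b : K} (ha : a ≠ 0) (hb : b ≠ 0) (hab : a - b ≠ 0) (da db : E) :
    algebraMap K E b⁻¹ * (algebraMap K E a⁻¹ * da) =
      algebraMap K E (a - b)⁻¹ * (algebraMap K E b⁻¹ * db) +
      (algebraMap K E (a - b)⁻¹ * (da - db)) * algebraMap K E b⁻¹ -
        algebraMap K E (a - b)⁻¹ * (algebraMap K E a⁻¹ * da) := by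
  rw [← Algebra.commutes b⁻¹]
  simp only [← Algebra.smul_def, smul_smul]
  linear_combination (norm := module) (rel_scal ha hb hab) • da

theorem rel_ut {a b : K} (ha : a ≠ 0) (hb : b ≠ 0) (hab : a - b ≠ 0) (da db : E) :
    (algebraMap K E b⁻¹ * db) * algebraMap K E a⁻¹ =
      algebraMap K E (a - b)⁻¹ * (algebraMap K E b⁻¹ * db) +
      (algebraMap K E (a - b)⁻¹ * (da - db)) * algebraMap K E a⁻¹ -
        algebraMap K E (a - b)⁻¹ * (algebraMap K E a⁻¹ * da) := by
  rw [← Algebra.commutes a⁻¹, ← Algebra.commutes a⁻¹]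
  simp only [← Algebra.smul_def, smul_smul]
  linear_combination (norm := module) (rel_scal ha hb hab) • db

theorem rel_uu {a b : K} (ha : a ≠ 0) (hb : b ≠ 0) (hab : a - b ≠ 0) (da db : E)
    (h1 : da * da = 0) (h2 : db * db = 0) (h3 : db * da = - (da * db)) :
    (algebraMap K E b⁻¹ * db) * (algebraMap K E a⁻¹ * da) =
      (algebraMap K E (a - b)⁻¹ * (da - db)) * (algebraMap K E a⁻¹ * da) -
      (algebraMap K E (a - b)⁻¹ * (da - db)) * (algebraMap K E b⁻¹ * db) := by
  simp only [← Algebra.smul_def, smul_mul_smul_comm, sub_mul, h1, h2, h3]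
  linear_combination (norm := module) (-1 : K) • (rel_scal ha hb hab) • (da * db)

variable (p x d) in
def gens (k : ℕ) : Set E := {y | ∃ v : Fin k → ZMod p, v ≠ 0 ∧ (y = tt p x E k v ∨ y = uu p x d k v)}

variable (p x d) in
def AA (k : ℕ) : Subalgebra (ZMod p) E := Algebra.adjoin (ZMod p) (gens p x d k)

variable (p x d) in
/-- the span of the two generators attached to a vector -/
def GG (k : ℕ) (v : Fin k → ZMod p) : Submodule (ZMod p) E :=
  Submodule.span (ZMod p) {tt p x E k v, uu p x d k v}

theorem tt_mem_GG (k : ℕ) (v : Fin k → ZMod p) : tt p x E k v ∈ GG p x d k v :=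
  Submodule.subset_span (by simp)

theorem uu_mem_GG (k : ℕ) (v : Fin k → ZMod p) : uu p x d k v ∈ GG p x d k v :=
  Submodule.subset_span (by simp)

theorem dd_anti (hdd : ∀ k v, dd p d k v * dd p d k v = 0) (k : ℕ) (v w : Fin k → ZMod p) :
    dd p d k v * dd p d k w = - (dd p d k w * dd p d k v) := by
  have := hdd k (v - w)
  rw [dd_sub] at this
  simp only [sub_mul, mul_sub, hdd, zero_sub, sub_zero] at this
  have h2 : dd p d k v * dd p d k w + dd p d k w * dd p d k v = 0 := by
    rw [← neg_eq_zero, ← this]; abel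
  exact eq_neg_of_add_eq_zero_left h2

theorem uu_anti (hdd : ∀ k v, dd p d k v * dd p d k v = 0) (k : ℕ) (v w : Fin k → ZMod p) :
    uu p x d k v * uu p x d k w = - (uu p x d k w * uu p x d k v) := by
  simp only [uu, tt, ← Algebra.smul_def, smul_mul_smul_comm]
  rw [dd_anti hdd k v w, mul_comm, smul_neg]

theorem uu_sq (hdd : ∀ k v, dd p d k v * dd p d k v = 0) (k : ℕ) (v : Fin k → ZMod p) :
    uu p x d k v * uu p x d k v = 0 := by
  simp only [uu, tt, ← Algebra.smul_def, smul_mul_smul_comm, hdd, smul_zero]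

theorem GG_rel (hdd : ∀ k v, dd p d k v * dd p d k v = 0) {N : ℕ}
    (hx : ∀ k < N, Transcendental (KK p x k) (x k)) {k : ℕ} (hk : k ≤ N)
    {a b : Fin k → ZMod p} (ha : a ≠ 0) (hb : b ≠ 0) (hab : a ≠ b) :
    GG p x d k b * GG p x d k a ≤ GG p x d k (a - b) * GG p x d k b ⊔
      GG p x d k (a - b) * GG p x d k a := by
  have ha' := zz_ne_zero p x hx k hk a ha
  have hb' := zz_ne_zero p x hx k hk b hb
  have hab' := zz_ne_zero p x hx k hk (a - b) (sub_ne_zero.2 hab)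
  rw [zz_sub] at hab'
  set Q := GG p x d k (a - b) * GG p x d k b ⊔ GG p x d k (a - b) * GG p x d k a with hQ
  have mb : ∀ g ∈ GG p x d k (a - b), ∀ h ∈ GG p x d k b, g * h ∈ Q := fun g hg h hh =>
    (le_sup_left : _ ≤ Q) (Submodule.mul_mem_mul hg hh)
  have ma : ∀ g ∈ GG p x d k (a - b), ∀ h ∈ GG p x d k a, g * h ∈ Q := fun g hg h hh =>
    (le_sup_right : _ ≤ Q) (Submodule.mul_mem_mul hg hh)
  have tg := tt_mem_GG (E := E) (x := x) (d := d) k (a - b)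
  have ug := uu_mem_GG (x := x) (d := d) k (a - b)
  have ta := tt_mem_GG (E := E) (x := x) (d := d) k a
  have ua := uu_mem_GG (x := x) (d := d) k a
  have tb := tt_mem_GG (E := E) (x := x) (d := d) k b
  have ub := uu_mem_GG (x := x) (d := d) k b
  simp only [uu, tt, zz_sub, dd_sub] at tg ug ta ua tb ub
  conv_lhs => rw [GG, GG, Submodule.span_mul_span]
  rw [Submodule.span_le]
  rintro _ ⟨g, hg, h, hh, rfl⟩
  simp only [Set.mem_insert_iff, Set.mem_singleton_iff] at hg hh
  simp only [SetLike.mem_coe]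
  rcases hg with rfl | rfl <;> rcases hh with rfl | rfl
  · simp only [tt]
    rw [rel_tt ha' hb' hab']
    exact sub_mem (mb _ tg _ tb) (ma _ tg _ ta)
  · simp only [tt, uu]
    rw [rel_tu ha' hb' hab' _ (dd p d k b)]
    exact sub_mem (add_mem (mb _ tg _ ub) (mb _ ug _ tb)) (ma _ tg _ ua)
  · simp only [tt, uu]
    rw [rel_ut ha' hb' hab' (dd p d k a)]
    exact sub_mem (add_mem (mb _ tg _ ub) (ma _ ug _ ta)) (ma _ tg _ ua)
  · simp only [tt, uu]
    rw [rel_uu ha' hb' hab' _ _ (hdd _ _) (hdd _ _) (dd_anti hdd _ _ _)]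
    exact sub_mem (ma _ ug _ ua) (mb _ ug _ ub)

theorem gens_mono (k : ℕ) : gens p x d k ⊆ gens p x d (k + 1) := by
  rintro y ⟨v, hv, h⟩
  refine ⟨Fin.snoc v 0, ?_, ?_⟩
  · rintro h
    apply hv
    ext i
    simpa using congrFun h i.castSucc
  · rwa [tt_snoc_zero, uu_snoc_zero]

theorem snoc_one_ne (k : ℕ) (v : Fin k → ZMod p) :
    (Fin.snoc v 1 : Fin (k + 1) → ZMod p) ≠ 0 := fun h => by
  simpa using congrFun h (Fin.last k)

theorem GG_sub_le (k : ℕ) {a b : Fin k → ZMod p} (hab : a ≠ b) :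
    GG p x d (k + 1) (Fin.snoc a 1 - Fin.snoc b 1) ≤ Subalgebra.toSubmodule (AA p x d k) := by
  have : (Fin.snoc a 1 - Fin.snoc b 1 : Fin (k + 1) → ZMod p) = Fin.snoc (a - b) 0 := by
    ext i
    refine Fin.lastCases ?_ (fun i => ?_) i <;> simp
  rw [this, GG, Submodule.span_le, tt_snoc_zero, uu_snoc_zero]
  rintro y (rfl | rfl)
  · exact Algebra.subset_adjoin ⟨a - b, sub_ne_zero.2 hab, Or.inl rfl⟩
  · exact Algebra.subset_adjoin ⟨a - b, sub_ne_zero.2 hab, Or.inr rfl⟩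

theorem signcomm (hdd : ∀ k v, dd p d k v * dd p d k v = 0) {k : ℕ} (v w : Fin k → ZMod p)
    {g h : E} (hg : g = tt p x E k v ∨ g = uu p x d k v)
    (hh : h = tt p x E k w ∨ h = uu p x d k w) : g * h = h * g ∨ g * h = - (h * g) := by
  rcases hg with rfl | rfl
  · exact Or.inl (tt_comm _ _ _)
  · rcases hh with rfl | rfl
    · exact Or.inl (tt_comm _ _ _).symm
    · exact Or.inr (uu_anti hdd _ _ _)

theorem GG_comm (hdd : ∀ k v, dd p d k v * dd p d k v = 0) (k : ℕ) (v : Fin (k + 1) → ZMod p) :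
    GG p x d (k + 1) v * Subalgebra.toSubmodule (AA p x d k) ≤
      Subalgebra.toSubmodule (AA p x d k) * GG p x d (k + 1) v := by
  conv_lhs => rw [GG, AA, Algebra.adjoin_eq_span, Submodule.span_mul_span]
  rw [Submodule.span_le]
  rintro _ ⟨g, hg, c, hc, rfl⟩
  simp only [SetLike.mem_coe]
  have key : ∀ c ∈ Submonoid.closure (gens p x d k), g * c = c * g ∨ g * c = - (c * g) := by
    intro c hc
    induction hc using Submonoid.closure_induction with
    | mem y hy =>
      obtain ⟨w, -, h⟩ := gens_mono k hy
      exact signcomm hdd v w (by simpa using hg) h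
    | one => simp
    | mul a b _ _ iha ihb =>
      rcases iha with h | h <;> rcases ihb with h' | h'
      · left; rw [← mul_assoc, h, mul_assoc, h', mul_assoc]
      · right; rw [← mul_assoc, h, mul_assoc, h', mul_assoc, mul_neg]
      · right; rw [← mul_assoc, h, neg_mul, mul_assoc, h', mul_assoc]
      · left; rw [← mul_assoc, h, neg_mul, mul_assoc, h', mul_assoc, mul_neg, neg_neg]
  have hcA : c ∈ Subalgebra.toSubmodule (AA p x d k) := by
    rw [AA, Algebra.adjoin_eq_span]; exact Submodule.subset_span hc
  have hgG : g ∈ GG p x d (k + 1) v := Submodule.subset_span hg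
  rcases key c hc with h | h <;> rw [h]
  · exact Submodule.mul_mem_mul hcA hgG
  · exact neg_mem (Submodule.mul_mem_mul hcA hgG)

theorem AA_mul (k : ℕ) : Subalgebra.toSubmodule (AA p x d k) * Subalgebra.toSubmodule (AA p x d k) ≤
    Subalgebra.toSubmodule (AA p x d k) := by
  rw [Submodule.mul_le]
  exact fun a ha b hb => (AA p x d k).mul_mem ha hb

theorem GG_pow_comm (hdd : ∀ k v, dd p d k v * dd p d k v = 0) (k : ℕ)
    (v : Fin (k + 1) → ZMod p) (m : ℕ) :
    GG p x d (k + 1) v ^ m * Subalgebra.toSubmodule (AA p x d k) ≤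
      Subalgebra.toSubmodule (AA p x d k) * GG p x d (k + 1) v ^ m := by
  induction m with
  | zero => simp
  | succ m ih =>
    rw [pow_succ, mul_assoc]
    calc _ ≤ GG p x d (k + 1) v ^ m * (Subalgebra.toSubmodule (AA p x d k) * GG p x d (k + 1) v) :=
          mR (GG_comm hdd k v)
      _ ≤ _ := by
        rw [← mul_assoc, ← mul_assoc]
        exact mL ih

variable (p x d) in
def MM (k : ℕ) : Submodule (ZMod p) E :=
  ⨆ q : (Fin k → ZMod p) × ℕ, Subalgebra.toSubmodule (AA p x d k) *
    GG p x d (k + 1) (Fin.snoc q.1 1) ^ q.2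

theorem le_MM (k : ℕ) (b : Fin k → ZMod p) (m : ℕ) : Subalgebra.toSubmodule (AA p x d k) *
    GG p x d (k + 1) (Fin.snoc b 1) ^ m ≤ MM p x d k :=
  le_iSup (fun q : (Fin k → ZMod p) × ℕ => Subalgebra.toSubmodule (AA p x d k) *
    GG p x d (k + 1) (Fin.snoc q.1 1) ^ q.2) (b, m)

theorem MM_mul_AA (hdd : ∀ k v, dd p d k v * dd p d k v = 0) (k : ℕ) :
    MM p x d k * Subalgebra.toSubmodule (AA p x d k) ≤ MM p x d k := by
  conv_lhs => rw [MM, Submodule.iSup_mul]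
  refine iSup_le fun ⟨b, m⟩ => ?_
  refine le_trans ?_ (le_MM k b m)
  rw [mul_assoc]
  refine (mR (GG_pow_comm hdd k _ m)).trans ?_
  rw [← mul_assoc]
  exact mL (AA_mul k)

theorem MM_mul_GG (hdd : ∀ k v, dd p d k v * dd p d k v = 0) {N : ℕ}
    (hx : ∀ k < N, Transcendental (KK p x k) (x k)) {k : ℕ} (hk : k < N) (a : Fin k → ZMod p) :
    MM p x d k * GG p x d (k + 1) (Fin.snoc a 1) ≤ MM p x d k := by
  conv_lhs => rw [MM, Submodule.iSup_mul]
  refine iSup_le fun ⟨b, m⟩ => ?_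
  simp only
  by_cases hab : a = b
  · subst hab
    rw [mul_assoc, ← pow_succ]
    exact le_MM k a _
  induction m with
  | zero =>
    rw [pow_zero, mul_one, ← pow_one (GG p x d _ _)]
    exact le_MM k a _
  | succ m ih =>
    set P := Subalgebra.toSubmodule (AA p x d k)
    set Ga := GG p x d (k + 1) (Fin.snoc a 1)
    set Gb := GG p x d (k + 1) (Fin.snoc b 1)
    have hne : (Fin.snoc a 1 : Fin (k + 1) → ZMod p) ≠ Fin.snoc b 1 := fun h => hab (by
      have := congrArg Fin.init h; simpa using this)
    have h1 : Gb * Ga ≤ P * (Gb ⊔ Ga) := by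
      refine (GG_rel hdd hx hk (snoc_one_ne k a) (snoc_one_ne k b) hne).trans ?_
      rw [← Submodule.mul_sup]
      exact mL (GG_sub_le k hab)
    calc P * Gb ^ (m + 1) * Ga = P * Gb ^ m * (Gb * Ga) := by rw [pow_succ]; simp only [mul_assoc]
      _ ≤ P * Gb ^ m * (P * (Gb ⊔ Ga)) := mR h1
      _ = P * (Gb ^ m * P) * (Gb ⊔ Ga) := by simp only [mul_assoc]
      _ ≤ P * (P * Gb ^ m) * (Gb ⊔ Ga) :=
        mL (mR (GG_pow_comm hdd k _ m))
      _ = (P * P) * (Gb ^ m * (Gb ⊔ Ga)) := by simp only [mul_assoc]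
      _ ≤ P * (Gb ^ m * (Gb ⊔ Ga)) := mL (AA_mul k)
      _ = P * Gb ^ (m + 1) ⊔ P * Gb ^ m * Ga := by
        rw [Submodule.mul_sup, Submodule.mul_sup, pow_succ, mul_assoc]
      _ ≤ _ := sup_le (le_MM k b _) ih

theorem gens_cases (k : ℕ) {g : E} (hg : g ∈ gens p x d (k + 1)) :
    g ∈ AA p x d k ∨ ∃ a : Fin k → ZMod p, g ∈ GG p x d (k + 1) (Fin.snoc a 1) := by
  obtain ⟨v, hv, h⟩ := hg
  obtain ⟨w, c, rfl⟩ : ∃ w c, v = Fin.snoc w c := ⟨Fin.init v, v (Fin.last k), by simp⟩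
  by_cases hc : c = 0
  · subst hc
    left
    refine Algebra.subset_adjoin ⟨w, ?_, ?_⟩
    · rintro rfl
      apply hv
      ext i
      refine Fin.lastCases ?_ (fun i => ?_) i <;> simp
    · rwa [tt_snoc_zero, uu_snoc_zero] at h
  · right
    refine ⟨c⁻¹ • w, ?_⟩
    have e : (Fin.snoc w c : Fin (k + 1) → ZMod p) = c • Fin.snoc (c⁻¹ • w) 1 := by
      ext i
      refine Fin.lastCases ?_ (fun i => ?_) i
      · simp
      · simp [hc]
    have hc' : algebraMap (ZMod p) K c ≠ 0 := by simpa using hc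
    have ht : tt p x E (k + 1) (c • Fin.snoc (c⁻¹ • w) 1) =
        c⁻¹ • tt p x E (k + 1) (Fin.snoc (c⁻¹ • w) 1) := by
      rw [tt, zz_smul, mul_inv, map_mul, ← map_inv₀, ← IsScalarTower.algebraMap_apply,
        tt, Algebra.smul_def c⁻¹ (algebraMap K E _)]
    rw [e] at h
    rcases h with rfl | rfl
    · rw [ht]
      exact Submodule.smul_mem _ _ (tt_mem_GG _ _)
    · rw [uu, ht, dd_smul, ← Algebra.smul_def, smul_mul_smul_comm, inv_mul_cancel₀ hc, one_smul]
      exact uu_mem_GG _ _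

theorem AA_le_MM (hdd : ∀ k v, dd p d k v * dd p d k v = 0) {N : ℕ}
    (hx : ∀ k < N, Transcendental (KK p x k) (x k)) {k : ℕ} (hk : k < N) :
    Subalgebra.toSubmodule (AA p x d (k + 1)) ≤ MM p x d k := by
  have key : ∀ y ∈ AA p x d (k + 1), ∀ m ∈ MM p x d k, m * y ∈ MM p x d k := by
    intro y hy
    refine Algebra.adjoin_induction (p := fun y _ => ∀ m ∈ MM p x d k, m * y ∈ MM p x d k)
      ?_ ?_ ?_ ?_ hy
    · intro y hy m hm
      rcases gens_cases k hy with h | ⟨a, h⟩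
      · exact MM_mul_AA hdd k (Submodule.mul_mem_mul hm h)
      · exact MM_mul_GG hdd hx hk a (Submodule.mul_mem_mul hm h)
    · intro r m hm
      rw [← Algebra.commutes, ← Algebra.smul_def]
      exact Submodule.smul_mem _ _ hm
    · intro a b _ _ ha hb m hm
      rw [mul_add]
      exact add_mem (ha m hm) (hb m hm)
    · intro a b _ _ ha hb m hm
      rw [← mul_assoc]
      exact hb _ (ha m hm)
  intro y hy
  rw [← one_mul y]
  refine key y hy 1 ?_
  apply le_MM k 0 0
  rw [pow_zero, mul_one]
  exact one_mem (AA p x d k)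

variable (p x d) in
/-- span of the monomials attached to one vector -/
def BB (k : ℕ) : (Fin k → ZMod p) → Submodule (ZMod p) E := fun v =>
  Submodule.span (ZMod p) {y | ∃ m : ℕ, y = tt p x E k v ^ m ∨ y = tt p x E k v ^ m * uu p x d k v}

theorem GG_pow_le (hdd : ∀ k v, dd p d k v * dd p d k v = 0) (k : ℕ) (v : Fin k → ZMod p)
    (m : ℕ) : GG p x d k v ^ m ≤ BB p x d k v := by
  induction m with
  | zero =>
    rw [pow_zero, Submodule.one_le]
    exact Submodule.subset_span ⟨0, Or.inl (by simp)⟩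
  | succ m ih =>
    rw [pow_succ]
    refine (mL ih).trans ?_
    conv_lhs => rw [BB, GG, Submodule.span_mul_span]
    rw [Submodule.span_le]
    rintro _ ⟨_, ⟨n, rfl | rfl⟩, _, rfl | rfl, rfl⟩
    · exact Submodule.subset_span ⟨n + 1, Or.inl (by simp [pow_succ])⟩
    · exact Submodule.subset_span ⟨n, Or.inr rfl⟩
    · refine Submodule.subset_span ⟨n + 1, Or.inr ?_⟩
      simp only [pow_succ, mul_assoc, tt_comm]
    · simp only [mul_assoc, uu_sq hdd, mul_zero]
      exact zero_mem _

theorem can_mem (k : ℕ) (j : J p k) : can p x d k j ∈ AA p x d k := by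
  induction k with
  | zero => exact one_mem _
  | succ k ih =>
    have h1 : AA p x d k ≤ AA p x d (k + 1) := Algebra.adjoin_mono (gens_mono k)
    refine mul_mem (h1 (ih j.1)) ?_
    have ht : ∀ α, tt p x E (k + 1) (Fin.snoc α 1) ∈ AA p x d (k + 1) := fun α =>
      Algebra.subset_adjoin ⟨_, snoc_one_ne k α, Or.inl rfl⟩
    have hu : ∀ α, uu p x d (k + 1) (Fin.snoc α 1) ∈ AA p x d (k + 1) := fun α =>
      Algebra.subset_adjoin ⟨_, snoc_one_ne k α, Or.inr rfl⟩
    rcases j.2 with _ | ⟨α, m, _ | _⟩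
    · exact one_mem _
    · exact pow_mem (ht α) _
    · exact mul_mem (pow_mem (ht α) _) (hu α)

theorem span_main (hdd : ∀ k v, dd p d k v * dd p d k v = 0) {N : ℕ}
    (hx : ∀ k < N, Transcendental (KK p x k) (x k)) (k : ℕ) (hk : k ≤ N) :
    Submodule.span (ZMod p) (Set.range (can p x d k)) = Subalgebra.toSubmodule (AA p x d k) := by
  apply le_antisymm
  · rw [Submodule.span_le]
    rintro _ ⟨j, rfl⟩
    exact can_mem k j
  induction k with
  | zero =>
    have : gens p x d 0 = ∅ := by
      ext y
      simp only [gens, Set.mem_ofPred_eq, Set.mem_empty_iff_false, iff_false]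
      rintro ⟨v, hv, -⟩
      exact hv (Subsingleton.elim _ _)
    rw [AA, this, Algebra.adjoin_empty]
    intro y hy
    obtain ⟨c, rfl⟩ := Algebra.mem_bot.1 hy
    rw [Algebra.algebraMap_eq_smul_one]
    exact Submodule.smul_mem _ _ (Submodule.subset_span ⟨(), rfl⟩)
  | succ k ih =>
    refine (AA_le_MM hdd hx hk).trans (iSup_le fun ⟨b, m⟩ => ?_)
    refine (mR (GG_pow_le hdd _ _ m)).trans ?_
    refine (mL (ih (by omega))).trans ?_
    rw [BB, Submodule.span_mul_span, Submodule.span_le]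
    rintro _ ⟨_, ⟨j, rfl⟩, _, ⟨n, rfl | rfl⟩, rfl⟩
    · rcases n with _ | n
      · exact Submodule.subset_span ⟨(j, none), by simp [can, wt]⟩
      · exact Submodule.subset_span ⟨(j, some (b, n, false)), by simp [can, wt]⟩
    · exact Submodule.subset_span ⟨(j, some (b, n, true)), by simp [can, wt]⟩

end

/-! ### combinatorics of the index set -/

section
variable {p : ℕ}

def hS : (k : ℕ) → J p k → Finset (Fin k → ZMod p)
  | 0, _ => ∅
  | k + 1, j =>
    match j.2 with
    | none => (hS k j.1).image fun v => Fin.snoc v (0 : ZMod p)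
    | some q => ((hS k j.1).image fun v => Fin.snoc v (0 : ZMod p)) ∪ {Fin.snoc q.1 (1 : ZMod p)}

def hm : (k : ℕ) → J p k → (Fin k → ZMod p) → ℕ
  | 0, _ => fun _ => 0
  | k + 1, j => fun v =>
    if v (Fin.last k) = 0 then hm k j.1 (Fin.init v) else
    match j.2 with
    | none => 0
    | some q => if v = Fin.snoc q.1 (1 : ZMod p) then (if q.2.2 then q.2.1 else q.2.1 + 1) else 0

def he : (k : ℕ) → J p k → (Fin k → ZMod p) → Bool
  | 0, _ => fun _ => false
  | k + 1, j => fun v =>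
    if v (Fin.last k) = 0 then he k j.1 (Fin.init v) else
    match j.2 with
    | none => false
    | some q => if v = Fin.snoc q.1 (1 : ZMod p) then q.2.2 else false

theorem hS_mem (k : ℕ) (j : J p k) : hS k j ∈ Fn p k := by
  induction k with
  | zero => rfl
  | succ k ih =>
    rw [hS]
    rcases j.2 with _ | q
    · exact Or.inl ⟨_, ih j.1, rfl⟩
    · exact Or.inr ⟨_, ih j.1, q.1, rfl⟩

theorem snoc_mem_image {k : ℕ} (S : Finset (Fin k → ZMod p)) (w : Fin k → ZMod p) (a : ZMod p) :
    (Fin.snoc w a : Fin (k + 1) → ZMod p) ∈ (S.image fun v => Fin.snoc v (0 : ZMod p)) ↔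
      w ∈ S ∧ a = 0 := by
  simp only [Finset.mem_image]
  constructor
  · rintro ⟨v, hv, h⟩
    have := Fin.snoc_injective2 h
    rw [← this.1, ← this.2]
    exact ⟨hv, rfl⟩
  · rintro ⟨h, rfl⟩
    exact ⟨w, h, rfl⟩

theorem snoc_eq_iff {k : ℕ} (w w' : Fin k → ZMod p) (a a' : ZMod p) :
    (Fin.snoc w a : Fin (k + 1) → ZMod p) = Fin.snoc w' a' ↔ w = w' ∧ a = a' :=
  ⟨fun h => Fin.snoc_injective2 h, by rintro ⟨rfl, rfl⟩; rfl⟩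

theorem h_props [Fact p.Prime] (k : ℕ) (j : J p k) :
    (∀ α ∈ hS k j, 1 ≤ hm k j α + (if he k j α then 1 else 0)) ∧
      ∀ α ∉ hS k j, hm k j α = 0 ∧ he k j α = false := by
  induction k with
  | zero => simp [hS, hm, he]
  | succ k ih =>
    obtain ⟨j, o⟩ := j
    obtain ⟨h1, h2⟩ := ih j
    constructor
    · intro α
      obtain ⟨w, c, rfl⟩ : ∃ w c, α = Fin.snoc w c := ⟨Fin.init α, α (Fin.last k), by simp⟩
      rcases o with _ | ⟨q, m, b⟩
      · simp only [hS, snoc_mem_image, hm, he, Fin.snoc_last, Fin.init_snoc]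
        rintro ⟨h, rfl⟩
        simpa using h1 w h
      · simp only [hS, snoc_mem_image, hm, he, Fin.snoc_last, Fin.init_snoc, Finset.mem_union,
          Finset.mem_singleton, snoc_eq_iff]
        rintro (⟨h, rfl⟩ | ⟨rfl, rfl⟩)
        · simpa using h1 w h
        · cases b <;> simp
    · intro α
      obtain ⟨w, c, rfl⟩ : ∃ w c, α = Fin.snoc w c := ⟨Fin.init α, α (Fin.last k), by simp⟩
      rcases o with _ | ⟨q, m, b⟩
      · simp only [hS, snoc_mem_image, hm, he, Fin.snoc_last, Fin.init_snoc]
        intro h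
        by_cases hc : c = 0
        · simpa [hc] using h2 w (by tauto)
        · simp [hc]
      · simp only [hS, snoc_mem_image, hm, he, Fin.snoc_last, Fin.init_snoc, Finset.mem_union,
          Finset.mem_singleton, snoc_eq_iff]
        intro h
        by_cases hc : c = 0
        · simpa [hc] using h2 w (by tauto)
        · have : ¬ (w = q ∧ c = 1) := by tauto
          simp [hc, this]

theorem h_surj [Fact p.Prime] (k : ℕ) (S : Finset (Fin k → ZMod p)) (m : (Fin k → ZMod p) → ℕ)
    (e : (Fin k → ZMod p) → Bool) (hS' : S ∈ Fn p k)
    (h1 : ∀ α ∈ S, 1 ≤ m α + (if e α then 1 else 0))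
    (h2 : ∀ α ∉ S, m α = 0 ∧ e α = false) : ∃ j, hS k j = S ∧ hm k j = m ∧ he k j = e := by
  induction k with
  | zero =>
    obtain rfl : S = ∅ := hS'
    refine ⟨(), rfl, ?_, ?_⟩
    · ext v; exact (h2 v (by simp)).1.symm
    · ext v; rw [(h2 v (by simp)).2]; rfl
  | succ k ih =>
    have hext : ∀ {T : Type} {f g : (Fin (k + 1) → ZMod p) → T},
        (∀ w c, f (Fin.snoc w c) = g (Fin.snoc w c)) → f = g := by
      intro T f g h
      ext v
      rw [← Fin.snoc_init_self v]
      exact h _ _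
    rcases hS' with ⟨S', hS', rfl⟩ | ⟨S', hS', q, rfl⟩
    · simp only at h1 h2
      obtain ⟨j, rfl, j2, j3⟩ := ih S' (fun v => m (Fin.snoc v 0)) (fun v => e (Fin.snoc v 0)) hS'
        (fun α hα => h1 _ ((snoc_mem_image _ _ _).2 ⟨hα, rfl⟩))
        (fun α hα => h2 _ (fun h => hα ((snoc_mem_image _ _ _).1 h).1))
      refine ⟨(j, none), rfl, hext fun w c => ?_, hext fun w c => ?_⟩ <;>
      · simp only [hm, he, Fin.snoc_last, Fin.init_snoc, j2, j3]
        by_cases hc : c = 0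
        · simp [hc]
        · have := h2 (Fin.snoc w c) (fun h => hc ((snoc_mem_image _ _ _).1 h).2)
          simp [hc, this]
    · have hmem : ∀ w c, (Fin.snoc w c : Fin (k + 1) → ZMod p) ∈
          ((S'.image fun v => Fin.snoc v (0 : ZMod p)) ∪ {Fin.snoc q (1 : ZMod p)}) ↔
          (w ∈ S' ∧ c = 0) ∨ (w = q ∧ c = 1) := by
        intro w c
        rw [Finset.mem_union, snoc_mem_image, Finset.mem_singleton, snoc_eq_iff]
      obtain ⟨j, rfl, j2, j3⟩ := ih S' (fun v => m (Fin.snoc v 0)) (fun v => e (Fin.snoc v 0)) hS'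
        (fun α hα => h1 _ ((hmem _ _).2 (Or.inl ⟨hα, rfl⟩)))
        (fun α hα => h2 _ (fun h => by
          rcases (hmem _ _).1 h with h | h
          · exact hα h.1
          · exact zero_ne_one h.2))
      have h3 := h1 (Fin.snoc q 1) ((hmem _ _).2 (Or.inr ⟨rfl, rfl⟩))
      refine ⟨(j, some (q, if e (Fin.snoc q 1) then m (Fin.snoc q 1) else m (Fin.snoc q 1) - 1,
        e (Fin.snoc q 1))), rfl, hext fun w c => ?_, hext fun w c => ?_⟩
      · simp only [hm, Fin.snoc_last, Fin.init_snoc, j2, snoc_eq_iff]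
        by_cases hc : c = 0
        · simp [hc]
        · by_cases hw : w = q ∧ c = 1
          · obtain ⟨rfl, rfl⟩ := hw
            cases hb : e (Fin.snoc w 1)
            · simp [hb] at h3 ⊢
              omega
            · simp
          · have := h2 (Fin.snoc w c) (fun h => by
              rcases (hmem _ _).1 h with h | h
              · exact hc h.2
              · exact hw h)
            simp [hc, hw, this]
      · simp only [he, Fin.snoc_last, Fin.init_snoc, j3, snoc_eq_iff]
        by_cases hc : c = 0
        · simp [hc]
        · by_cases hw : w = q ∧ c = 1
          · obtain ⟨rfl, rfl⟩ := hw
            simp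
          · have := h2 (Fin.snoc w c) (fun h => by
              rcases (hmem _ _).1 h with h | h
              · exact hc h.2
              · exact hw h)
            simp [hc, hw, this]

theorem can_list [Fact p.Prime] {K E : Type*} [Field K] [Ring E] [Algebra (ZMod p) K]
    [Algebra K E] [Algebra (ZMod p) E] [IsScalarTower (ZMod p) K E] {x : ℕ → K} {d : ℕ → E}
    (k : ℕ) (j : J p k) : ∃ l : List (Fin k → ZMod p), l.Nodup ∧ l.toFinset = hS k j ∧
      can p x d k j = (l.map fun v =>
        tt p x E k v ^ hm k j v * uu p x d k v ^ (if he k j v then 1 else 0)).prod := by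
  induction k with
  | zero => exact ⟨[], by simp, by simp [hS], by simp [can]⟩
  | succ k ih =>
    obtain ⟨j, o⟩ := j
    obtain ⟨l, l1, l2, l3⟩ := ih j
    have hn : (l.map fun v => (Fin.snoc v (0 : ZMod p) : Fin (k + 1) → ZMod p)).Nodup :=
      l1.map fun v w h => ((snoc_eq_iff _ _ _ _).1 h).1
    have hf : (l.map fun v => (Fin.snoc v (0 : ZMod p) : Fin (k + 1) → ZMod p)).toFinset =
        (hS k j).image fun v => Fin.snoc v (0 : ZMod p) := by
      rw [← l2]; ext v; simp
    have hp : ∀ o, ((l.map fun v => (Fin.snoc v (0 : ZMod p) : Fin (k + 1) → ZMod p)).map fun v =>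
        tt p x E (k + 1) v ^ hm (k + 1) (j, o) v *
          uu p x d (k + 1) v ^ (if he (k + 1) (j, o) v then 1 else 0)).prod = can p x d k j := by
      intro o
      rw [l3, List.map_map]
      congr 1
      apply List.map_congr_left
      intro v _
      simp [hm, he, tt_snoc_zero, uu_snoc_zero]
    rcases o with _ | ⟨q, m, b⟩
    · exact ⟨_, hn, hf, by rw [hp]; simp [can, wt]⟩
    · refine ⟨(l.map fun v => (Fin.snoc v (0 : ZMod p) : Fin (k + 1) → ZMod p)) ++ [Fin.snoc q 1],
        ?_, ?_, ?_⟩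
      · rw [List.nodup_append]
        refine ⟨hn, by simp, ?_⟩
        intro a ha b hb
        simp only [List.mem_map, List.mem_singleton] at ha hb
        obtain ⟨v, -, rfl⟩ := ha
        subst hb
        intro h
        exact zero_ne_one ((snoc_eq_iff _ _ _ _).1 h).2
      · rw [List.toFinset_append, hf]
        simp [hS]
      · rw [List.map_append, List.prod_append, hp]
        simp only [can]
        congr 1
        cases b <;> simp [wt, hm, he]

theorem perm_sign {V R : Type*} [Ring R] (f : V → R)
    (hf : ∀ a b, f a * f b = f b * f a ∨ f a * f b = - (f b * f a)) {l l' : List V}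
    (h : l.Perm l') : (l.map f).prod = (l'.map f).prod ∨ (l.map f).prod = - (l'.map f).prod := by
  induction h with
  | nil => simp
  | cons a _ ih => rcases ih with h | h <;> simp [h]
  | swap a b l =>
    rcases hf b a with h | h
    · left; simp [← mul_assoc, h]
    · right; simp [← mul_assoc, h]
  | trans _ _ ih ih' =>
    rcases ih with h | h <;> rcases ih' with h' | h' <;> simp [h, h']

theorem mon_sign [Fact p.Prime] {K E : Type*} [Field K] [Ring E] [Algebra (ZMod p) K]
    [Algebra K E] [Algebra (ZMod p) E] [IsScalarTower (ZMod p) K E] {x : ℕ → K} {d : ℕ → E}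
    (hdd : ∀ k v, dd p d k v * dd p d k v = 0) {k : ℕ} (v w : Fin k → ZMod p)
    (m m' : ℕ) (e e' : Bool) :
    let g := tt p x E k v ^ m * uu p x d k v ^ (if e then 1 else 0)
    let h := tt p x E k w ^ m' * uu p x d k w ^ (if e' then 1 else 0)
    g * h = h * g ∨ g * h = - (h * g) := by
  intro g h
  have c1 : ∀ b, Commute (tt p x E k v ^ m) b := fun b =>
    Commute.pow_left (tt_comm _ _ _) _
  have c2 : ∀ b, Commute (tt p x E k w ^ m') b := fun b =>
    Commute.pow_left (tt_comm _ _ _) _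
  have e1 : ∀ a b, (tt p x E k v ^ m * a) * (tt p x E k w ^ m' * b) =
      tt p x E k v ^ m * tt p x E k w ^ m' * (a * b) := by
    intro a b
    rw [mul_assoc, ← mul_assoc a, ← (c2 a).eq]; simp only [mul_assoc]
  have e2 : ∀ a b, (tt p x E k w ^ m' * b) * (tt p x E k v ^ m * a) =
      tt p x E k v ^ m * tt p x E k w ^ m' * (b * a) := by
    intro a b
    rw [mul_assoc, ← mul_assoc b, ← (c1 b).eq, (c1 (tt p x E k w ^ m')).eq]; simp only [mul_assoc]
  simp only [g, h, e1, e2]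
  cases e <;> cases e' <;> simp
  right
  rw [uu_anti hdd, mul_neg]

end

/-! ### the concrete setting -/

section
variable (p n : ℕ) [Fact p.Prime]

def xN (i : ℕ) : Kf p n := if h : i < n then xK p n ⟨i, h⟩ else 0

def eN (i : ℕ) : Fin n → Kf p n := if h : i < n then Pi.single ⟨i, h⟩ 1 else 0

def dN (i : ℕ) : Ef p n := ExteriorAlgebra.ι (Kf p n) (eN p n i)

def DN (k : ℕ) : Ef p n →ₗ[Kf p n] Ef p n :=
  if h : k < n then (CliffordAlgebra.contractRight
    (Q := (0 : QuadraticForm (Kf p n) (Fin n → Kf p n)))).flip (LinearMap.proj ⟨k, h⟩) else 0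

instance instTowerEf : IsScalarTower (ZMod p) (Kf p n) (Ef p n) :=
  IsScalarTower.of_algebraMap_eq fun _ => rfl

theorem cK_eq (a : ZMod p) : cK p n a = algebraMap (ZMod p) (Kf p n) a := by
  rw [IsScalarTower.algebraMap_apply (ZMod p) (MvPolynomial (Fin n) (ZMod p)) (Kf p n)]
  rfl

theorem zz_eq (v : Fin n → ZMod p) : zz p (xN p n) n v = zf p n v := by
  simp [zz, zf, xN, cK_eq]

theorem tt_eq (v : Fin n → ZMod p) : tt p (xN p n) (Ef p n) n v = tE p n v := by
  rw [tt, zz_eq, tE, tf]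

theorem dd_eq (v : Fin n → ZMod p) : dd p (dN p n) n v = dzf p n v := by
  simp only [dd, dzf, dN, eN, cK_eq, dxE, Fin.is_lt, dif_pos, Fin.eta]
  rfl

theorem uu_eq (v : Fin n → ZMod p) : uu p (xN p n) (dN p n) n v = uf p n v := by
  rw [uu, tt_eq, dd_eq, uf]

theorem AA_eq : AA p (xN p n) (dN p n) n = Af p n := by
  simp only [AA, gens, tt_eq, uu_eq, Af]

theorem dd_sq (k : ℕ) (v : Fin k → ZMod p) : dd p (dN p n) k v * dd p (dN p n) k v = 0 := by
  have : dd p (dN p n) k v = ExteriorAlgebra.ι (Kf p n)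
      (∑ i : Fin k, algebraMap (ZMod p) (Kf p n) (v i) • eN p n i) := by
    rw [map_sum]
    refine Finset.sum_congr rfl fun i _ => ?_
    rw [map_smul, Algebra.smul_def, ← IsScalarTower.algebraMap_apply]
    rfl
  rw [this]
  exact ExteriorAlgebra.ι_sq_zero _

theorem trans_xN (k : ℕ) (hk : k < n) : Transcendental (KK p (xN p n) k) (xN p n k) := by
  have h1 : AlgebraicIndependent (ZMod p) (xK p n) :=
    (MvPolynomial.algebraicIndependent_X (Fin n) (ZMod p)).map'
      (f := IsScalarTower.toAlgHom (ZMod p) (MvPolynomial (Fin n) (ZMod p)) (Kf p n))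
      (IsFractionRing.injective _ _)
  have h2 : xN p n '' Set.Iio k = xK p n '' {i | (i : ℕ) < k} := by
    ext y
    constructor
    · rintro ⟨i, hi, rfl⟩
      have hi' : i < k := hi
      exact ⟨⟨i, hi'.trans hk⟩, hi', by simp [xN, hi'.trans hk]⟩
    · rintro ⟨i, hi, rfl⟩
      exact ⟨i, hi, by simp [xN]⟩
  have h3 := h1.transcendental_adjoin (s := {i | (i : ℕ) < k}) (i := ⟨k, hk⟩) (by simp)
  rw [KK, IntermediateField.transcendental_adjoin_iff, h2]
  simpa [xN, hk] using h3

theorem DN_one (k : ℕ) (hk : k < n) : DN p n k 1 = 0 := by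
  simp only [DN, hk, dif_pos, LinearMap.flip_apply]
  rw [CliffordAlgebra.contractRight_one]

theorem DN_lt (k : ℕ) (hk : k < n) (b : Ef p n) (i : ℕ) (hi : i < k) :
    DN p n k (b * dN p n i) = - DN p n k b * dN p n i := by
  simp only [DN, hk, dif_pos, LinearMap.flip_apply, dN]
  rw [CliffordAlgebra.contractRight_mul_ι]
  have : (LinearMap.proj ⟨k, hk⟩ : Module.Dual (Kf p n) (Fin n → Kf p n)) (eN p n i) = 0 := by
    simp only [eN, hi.trans hk, dif_pos, LinearMap.proj_apply]
    exact Pi.single_eq_of_ne (by simp; omega) _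
  rw [this, zero_smul, zero_sub, neg_mul]

theorem DN_self (k : ℕ) (hk : k < n) (b : Ef p n) :
    DN p n k (b * dN p n k) = b - DN p n k b * dN p n k := by
  simp only [DN, hk, dif_pos, LinearMap.flip_apply, dN]
  rw [CliffordAlgebra.contractRight_mul_ι]
  have : (LinearMap.proj ⟨k, hk⟩ : Module.Dual (Kf p n) (Fin n → Kf p n)) (eN p n k) = 1 := by
    simp [eN, hk]
  rw [this, one_smul]

theorem can_li : LinearIndependent (ZMod p) (can p (xN p n) (dN p n) n) := by
  have h := li_main (p := p) (x := xN p n) (d := dN p n) (N := n) (trans_xN p n) (DN p n)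
    (DN_one p n) (DN_lt p n) (DN_self p n) n le_rfl (I := Unit) (fun _ => 1)
    (by rw [linearIndependent_unique_iff]; exact one_ne_zero)
  have h2 := h.comp (fun j : J p n => ((), j)) (fun a b h => by simpa using h)
  convert h2 using 1
  ext j
  simp

theorem can_span : Submodule.span (ZMod p) (Set.range (can p (xN p n) (dN p n) n)) =
    Subalgebra.toSubmodule (Af p n) := by
  rw [← AA_eq]
  exact span_main (dd_sq p n) (trans_xN p n) n le_rfl

def HH (j : J p n) : Idx6 p n := ⟨(hS n j, hm n j, he n j), hS_mem n j, h_props n j⟩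

theorem HH_surj : Function.Surjective (HH p n) := by
  rintro ⟨⟨S, m, e⟩, h1, h2, h3⟩
  obtain ⟨j, j1, j2, j3⟩ := h_surj n S m e h1 h2 h3
  refine ⟨j, Subtype.ext ?_⟩
  simp only [HH, j1, j2, j3]

theorem can_mon (r : LinearOrder (Fin n → ZMod p)) (j : J p n) :
    can p (xN p n) (dN p n) n j = monFam p n r (HH p n j) ∨
      can p (xN p n) (dN p n) n j = - monFam p n r (HH p n j) := by
  obtain ⟨l, l1, l2, l3⟩ := can_list (x := xN p n) (d := dN p n) n j
  rw [l3]
  have := perm_sign (fun v => tt p (xN p n) (Ef p n) n v ^ hm n j v *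
    uu p (xN p n) (dN p n) n v ^ (if he n j v then 1 else 0))
    (fun a b => mon_sign (dd_sq p n) a b _ _ _ _) (l := l)
    (l' := letI := r; (hS n j).sort (· ≤ ·)) (by
      let _ := r
      rw [List.perm_ext_iff_of_nodup l1 (Finset.sort_nodup _ _)]
      intro a
      rw [Finset.mem_sort, ← l2]
      simp)
  simp only [tt_eq, uu_eq] at this ⊢
  exact this

theorem li_sign {R M ι : Type*} [Ring R] [AddCommGroup M] [Module R M] {v w : ι → M}
    (hv : LinearIndependent R v) (h : ∀ i, w i = v i ∨ w i = - v i) : LinearIndependent R w := by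
  have : ∀ i, ∃ c : Rˣ, w i = c • v i := by
    intro i
    rcases h i with h | h
    · exact ⟨1, by rw [h, one_smul]⟩
    · exact ⟨-1, by rw [h, Units.smul_def]; simp⟩
  choose c hc using this
  have h2 := hv.units_smul c
  convert h2 using 1
  ext i
  exact hc i

theorem final (r : LinearOrder (Fin n → ZMod p)) :
    LinearIndependent (ZMod p) (monFam p n r) ∧
      Submodule.span (ZMod p) (Set.range (monFam p n r)) =
        Subalgebra.toSubmodule (Af p n) := by
  have key : ∀ i : Idx6 p n, ∃ j, HH p n j = i ∧
      (monFam p n r i = can p (xN p n) (dN p n) n j ∨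
        monFam p n r i = - can p (xN p n) (dN p n) n j) := by
    intro i
    obtain ⟨j, rfl⟩ := HH_surj p n i
    refine ⟨j, rfl, ?_⟩
    rcases can_mon p n r j with h | h
    · exact Or.inl h.symm
    · exact Or.inr (by rw [h, neg_neg])
  choose s hs hc using key
  have hinj : Function.Injective s := fun a b h => by rw [← hs a, ← hs b, h]
  constructor
  · exact li_sign ((can_li p n).comp s hinj) hc
  · rw [← can_span]
    apply le_antisymm
    · rw [Submodule.span_le]
      rintro _ ⟨i, rfl⟩
      rcases hc i with h | h <;> rw [h]
      · exact Submodule.subset_span ⟨_, rfl⟩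
      · exact neg_mem (Submodule.subset_span ⟨_, rfl⟩)
    · rw [Submodule.span_le]
      rintro _ ⟨j, rfl⟩
      rcases can_mon p n r j with h | h <;> rw [h]
      · exact Submodule.subset_span ⟨_, rfl⟩
      · exact neg_mem (Submodule.subset_span ⟨_, rfl⟩)

end
end S6

/-- For an odd prime `p` and `n ≥ 1`, and any fixed linear order on `𝔽_p^n`, the family of
elements `Π_{α ∈ S} t_α^{m(α)}·u_α^{ε(α)}` of `E` (the product taken in increasing order
of `α`), indexed by triples `(S, m, ε)` with `S ∈ F_n`, `m : S → ℕ`, `ε : S → {0,1}` and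
`m(α) + ε(α) ≥ 1` for every `α ∈ S`, is an `𝔽_p`-vector-space basis of the subalgebra
`A`. -/
theorem stmt6 (p n : ℕ) [Fact (Nat.Prime p)] (hodd : Odd p) (hn : 1 ≤ n)
    (r : LinearOrder (Fin n → ZMod p)) :
    LinearIndependent (ZMod p) (monFam p n r) ∧
      Submodule.span (ZMod p) (Set.range (monFam p n r)) =
        Subalgebra.toSubmodule (Af p n) := by
  exact S6.final p n r

end
end
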